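/- Let φ : ℕ → ℕ be a nondecreasing function, and let ρ ≥ 3, ℓ ≥ 8ρ² + 6ρ, and d, τ ≥ 0. Then there exists an integer c ≥ 0 with the following property. Let G be a (ρ,φ)-controlled graph with χ(G) > c such that χ^{ρ−1}(G) ≤ τ and χ(J) ≤ τ for every induced subgraph J of G with ω(J) < ω(G). Then there is a d-peripheral hole of length exactly ℓ in G. -/

import Mathlib

open SimpleGraph

variable {V : Type*}

/-- The set of vertices at `G`-distance at most `ρ` from `v`. -/
def closedNbhd (G : SimpleGraph V) (v : V) (ρ : ℕ) : Set V :=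
  {u | G.Reachable v u ∧ G.dist v u ≤ ρ}

/-- `χ^ρ(G)`. -/
noncomputable def chiRho (G : SimpleGraph V) (ρ : ℕ) : ℕ∞ :=
  ⨆ v : V, (G.induce (closedNbhd G v ρ)).chromaticNumber

/-- `G` is `(ρ,φ)`-controlled. -/
def Controlled (ρ : ℕ) (φ : ℕ → ℕ) (G : SimpleGraph V) : Prop :=
  ∀ X : Set V, (G.induce X).chromaticNumber ≤ (φ (chiRho (G.induce X) ρ).toNat : ℕ∞)

/-- The set of vertices of `G` not in the range of `f` and with no neighbour in it. -/
def periphSet {W : Type*} (G : SimpleGraph V) (f : W → V) : Set V :=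
  {v | v ∉ Set.range f ∧ ∀ u ∈ Set.range f, ¬ G.Adj v u}

/-- `G` has a `d`-peripheral hole of length `n`. -/
def HasPeriphHole (G : SimpleGraph V) (d n : ℕ) : Prop :=
  4 ≤ n ∧ ∃ f : cycleGraph n ↪g G,
    (d : ℕ∞) < (G.induce (periphSet G f)).chromaticNumber

/-- `n` colours suffice to colour the vertices in `X` properly. -/
def ColorableOn (G : SimpleGraph V) (X : Set V) (n : ℕ) : Prop :=
  ∃ f : V → ℕ, (∀ v ∈ X, f v < n) ∧ ∀ u ∈ X, ∀ v ∈ X, G.Adj u v → f u ≠ f v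

theorem colorableOn_iff (G : SimpleGraph V) (X : Set V) (n : ℕ) :
    ColorableOn G X n ↔ (G.induce X).chromaticNumber ≤ n := by
  classical
  rw [chromaticNumber_le_iff_colorable]
  constructor
  · rintro ⟨f, hf, hadj⟩
    exact ⟨Coloring.mk (fun v => ⟨f v, hf v v.2⟩) fun {u v} huv h =>
      hadj u u.2 v v.2 huv (congrArg Fin.val h)⟩
  · rintro ⟨C⟩
    refine ⟨fun v => if h : v ∈ X then (C ⟨v, h⟩).val else 0, ?_, ?_⟩
    · intro v hv
      simp [hv]
    · intro u hu v hv huv h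
      simp only [hu, hv, dite_true] at h
      exact C.valid (v := ⟨u, hu⟩) (w := ⟨v, hv⟩) huv (Fin.ext h)

namespace ColorableOn

variable {G : SimpleGraph V} {X Y Z : Set V} {m n : ℕ}

theorem mono (h : ColorableOn G Y m) (hXY : X ⊆ Y) (hmn : m ≤ n) : ColorableOn G X n := by
  obtain ⟨f, hf, hadj⟩ := h
  exact ⟨f, fun v hv => (hf v (hXY hv)).trans_le hmn,
    fun u hu v hv => hadj u (hXY hu) v (hXY hv)⟩

theorem union (hY : ColorableOn G Y m) (hZ : ColorableOn G Z n) (hX : X ⊆ Y ∪ Z) :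
    ColorableOn G X (m + n) := by
  classical
  obtain ⟨f, hf, hfa⟩ := hY
  obtain ⟨g, hg, hga⟩ := hZ
  refine ⟨fun v => if v ∈ Y then f v else m + g v, ?_, ?_⟩
  · intro v hv
    by_cases hvY : v ∈ Y
    · simpa [hvY] using (hf v hvY).trans_le (Nat.le_add_right m n)
    · simpa [hvY] using hg v ((hX hv).resolve_left hvY)
  · intro u hu v hv huv h
    by_cases huY : u ∈ Y <;> by_cases hvY : v ∈ Y <;> simp only [huY, hvY, if_true, if_false] at h
    · exact hfa u huY v hvY huv h
    · have := hf u huY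
      omega
    · have := hf v hvY
      omega
    · exact hga u ((hX hu).resolve_left huY) v ((hX hv).resolve_left hvY) huv (by omega)

theorem of_empty (h : X ⊆ ∅) : ColorableOn G X n :=
  ⟨fun _ => 0, fun _ hv => (h hv).elim, fun _ hu => (h hu).elim⟩

theorem of_cover {ι : Type*} (S : Finset ι) (T : ι → Set V) (N : ℕ)
    (hX : ∀ v ∈ X, ∃ k ∈ S, v ∈ T k) (hT : ∀ k ∈ S, ColorableOn G (X ∩ T k) N) :
    ColorableOn G X (S.card * N) := by
  classical
  induction S using Finset.induction_on generalizing X with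
  | empty => exact of_empty fun v hv => by simpa using hX v hv
  | insert a S ha ih =>
    have h1 : ColorableOn G (X ∩ {v | ∃ k ∈ S, v ∈ T k}) (S.card * N) :=
      ih (fun v hv => hv.2) fun k hk =>
        (hT k (Finset.mem_insert_of_mem hk)).mono (fun v hv => ⟨hv.1.1, hv.2⟩) le_rfl
    refine (h1.union (hT a (Finset.mem_insert_self a S)) ?_).mono subset_rfl ?_
    · intro v hv
      obtain ⟨k, hk, hvk⟩ := hX v hv
      rcases Finset.mem_insert.1 hk with rfl | hk
      · exact Or.inr ⟨hv, hvk⟩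
      · exact Or.inl ⟨hv, k, hk, hvk⟩
    · rw [Finset.card_insert_of_notMem ha]
      ring_nf
      exact le_rfl

end ColorableOn

theorem exists_not_colorableOn {G : SimpleGraph V} {X : Set V} {ι : Type*} {N s : ℕ}
    (S : Finset ι) (T : ι → Set V) (hS : S.card ≤ s) (h : ¬ ColorableOn G X (s * N))
    (hX : ∀ v ∈ X, ∃ k ∈ S, v ∈ T k) : ∃ k ∈ S, ¬ ColorableOn G (X ∩ T k) N := by
  by_contra! hT
  exact h ((ColorableOn.of_cover S T N hX hT).mono subset_rfl (Nat.mul_le_mul_right N hS))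

/-- Discarding a part of `X` that needs at most `m` colours. -/
theorem not_colorableOn_of_cover {G : SimpleGraph V} {X Y Z : Set V} {m n : ℕ}
    (h : ¬ ColorableOn G X (m + n)) (hY : ColorableOn G Y m) (hX : X ⊆ Y ∪ Z) :
    ¬ ColorableOn G Z n :=
  fun hZ => h (hY.union hZ hX)

/-- The vertices that can be reached from `v` by a walk of length at most `k`. -/
def walkBall (G : SimpleGraph V) (k : ℕ) (v : V) : Set V :=
  {u | ∃ p : G.Walk v u, p.length ≤ k}

section walkBall

variable {G : SimpleGraph V} {u v w : V} {j k : ℕ}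

theorem self_mem_walkBall : v ∈ walkBall G k v := ⟨Walk.nil, Nat.zero_le k⟩

theorem walkBall_mono (h : u ∈ walkBall G j v) (hjk : j ≤ k) : u ∈ walkBall G k v := by
  obtain ⟨p, hp⟩ := h
  exact ⟨p, hp.trans hjk⟩

theorem walkBall_symm (h : u ∈ walkBall G k v) : v ∈ walkBall G k u := by
  obtain ⟨p, hp⟩ := h
  exact ⟨p.reverse, by simpa using hp⟩

theorem walkBall_trans (h : v ∈ walkBall G j u) (h' : w ∈ walkBall G k v) :
    w ∈ walkBall G (j + k) u := by
  obtain ⟨p, hp⟩ := h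
  obtain ⟨q, hq⟩ := h'
  exact ⟨p.append q, by rw [Walk.length_append]; omega⟩

theorem adj_mem_walkBall (h : G.Adj v u) (hk : 1 ≤ k) : u ∈ walkBall G k v :=
  ⟨h.toWalk, by simpa using hk⟩

theorem walkBall_adj (h : u ∈ walkBall G k v) (h' : G.Adj u w) : w ∈ walkBall G (k + 1) v :=
  walkBall_trans h (adj_mem_walkBall h' le_rfl)

theorem chain_mem_walkBall {t : ℕ → V} {m i : ℕ} (ht : ∀ j < m, G.Adj (t j) (t (j + 1)))
    (d : ℕ) (h : i + d ≤ m) : t (i + d) ∈ walkBall G d (t i) := by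
  induction d with
  | zero => exact self_mem_walkBall
  | succ d ih => exact walkBall_adj (ih (by omega)) (ht _ (by omega))

theorem chain_mem_walkBall' {t : ℕ → V} {m i j d : ℕ} (ht : ∀ j < m, G.Adj (t j) (t (j + 1)))
    (hij : i ≤ j) (hj : j ≤ m) (hd : j ≤ i + d) : t j ∈ walkBall G d (t i) := by
  obtain ⟨e, rfl⟩ := Nat.exists_eq_add_of_le hij
  exact walkBall_mono (chain_mem_walkBall ht e hj) (by omega)

theorem mem_walkBall_iff_dist : u ∈ walkBall G k v ↔ G.Reachable v u ∧ G.dist v u ≤ k := by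
  constructor
  · rintro ⟨p, hp⟩
    exact ⟨⟨p⟩, (dist_le p).trans hp⟩
  · rintro ⟨h, hd⟩
    obtain ⟨p, hp⟩ := h.exists_walk_length_eq_dist
    exact ⟨p, hp.trans_le hd⟩

theorem walkBall_eq_closedNbhd : walkBall G k v = closedNbhd G v k :=
  Set.ext fun _ => mem_walkBall_iff_dist

end walkBall

/-- The vertices `v 0, …, v m` are distinct and form an induced path in this order. -/
def IndPath (G : SimpleGraph V) (v : ℕ → V) (m : ℕ) : Prop :=
  ∀ i j, i < j → j ≤ m → v i ≠ v j ∧ (G.Adj (v i) (v j) ↔ j = i + 1)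

namespace IndPath

variable {G : SimpleGraph V} {v : ℕ → V} {m : ℕ}

theorem adj (h : IndPath G v m) {i : ℕ} (hi : i < m) : G.Adj (v i) (v (i + 1)) :=
  (h i (i + 1) (Nat.lt_succ_self i) hi).2.2 rfl

theorem not_adj (h : IndPath G v m) {i j : ℕ} (hij : i + 1 < j) (hj : j ≤ m) :
    ¬ G.Adj (v i) (v j) := fun ha => by
  have := (h i j (by omega) hj).2.1 ha
  omega

theorem shift (h : IndPath G v m) {a n : ℕ} (hn : a + n ≤ m) :
    IndPath G (fun j => v (a + j)) n := fun i j hij hj => by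
  obtain ⟨h1, h2⟩ := h (a + i) (a + j) (by omega) (by omega)
  exact ⟨h1, h2.trans (by omega)⟩

theorem mono (h : IndPath G v m) {n : ℕ} (hn : n ≤ m) : IndPath G v n :=
  fun i j hij hj => h i j hij (hj.trans hn)

theorem reverse (h : IndPath G v m) : IndPath G (fun j => v (m - j)) m := fun i j hij hj => by
  obtain ⟨h1, h2⟩ := h (m - j) (m - i) (by omega) (by omega)
  exact ⟨h1.symm, by rw [adj_comm, h2]; omega⟩

theorem cons (h : IndPath G v m) {a : V} (h0 : G.Adj a (v 0)) (h1 : ∀ j ≤ m, a ≠ v j)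
    (h2 : ∀ j, 1 ≤ j → j ≤ m → ¬ G.Adj a (v j)) :
    IndPath G (fun j => if j = 0 then a else v (j - 1)) (m + 1) := fun i j hij hj => by
  have hj0 : j ≠ 0 := by omega
  by_cases hi : i = 0
  · subst hi
    simp only [if_true, hj0, if_false]
    refine ⟨h1 _ (by omega), ?_⟩
    by_cases hj1 : j = 1
    · subst hj1
      simpa using h0
    · exact iff_of_false (h2 _ (by omega) (by omega)) (by omega)
  · simp only [hi, hj0, if_false]
    obtain ⟨h3, h4⟩ := h (i - 1) (j - 1) (by omega) (by omega)
    exact ⟨h3, h4.trans (by omega)⟩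

end IndPath

theorem geodesic_notMem {G : SimpleGraph V} {v : ℕ → V} {m : ℕ}
    (ht : ∀ j < m, G.Adj (v j) (v (j + 1))) (hm : v m ∉ walkBall G (m - 1) (v 0)) {i j d : ℕ}
    (hd : i + d < j) (hj : j ≤ m) : v j ∉ walkBall G d (v i) := by
  intro hmem
  have h1 := chain_mem_walkBall' (i := 0) (j := i) (d := i) ht (by omega) (by omega) (by omega)
  have h2 := chain_mem_walkBall' (i := j) (j := m) (d := m - j) ht hj le_rfl (by omega)
  exact hm (walkBall_mono (walkBall_trans (walkBall_trans h1 hmem) h2) (by omega))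

/-- A chain whose ends are at distance equal to its length is an induced path. -/
theorem IndPath.of_geodesic {G : SimpleGraph V} {v : ℕ → V} {m : ℕ}
    (ht : ∀ j < m, G.Adj (v j) (v (j + 1))) (hm : v m ∉ walkBall G (m - 1) (v 0)) :
    IndPath G v m := by
  intro i j hij hj
  refine ⟨fun h => geodesic_notMem ht hm (d := 0) (by omega) hj (by
    rw [h]; exact self_mem_walkBall), fun h => ?_, ?_⟩
  · by_contra hne
    exact geodesic_notMem ht hm (d := 1) (by omega) hj (adj_mem_walkBall h le_rfl)
  · rintro rfl
    exact ht i (by omega)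


/-- There is an induced path of length `n` from `a` to `b` with all vertices in `X`. -/
def PathIn (G : SimpleGraph V) (X : Set V) (a b : V) (n : ℕ) : Prop :=
  ∃ f : ℕ → V, f 0 = a ∧ f n = b ∧ (∀ i ≤ n, f i ∈ X) ∧ IndPath G f n

namespace PathIn

variable {G : SimpleGraph V} {X : Set V} {a b w : V} {n : ℕ}

theorem left_mem (h : PathIn G X a b n) : a ∈ X := by
  obtain ⟨f, rfl, -, hX, -⟩ := h
  exact hX 0 (Nat.zero_le n)

theorem right_mem (h : PathIn G X a b n) : b ∈ X := by
  obtain ⟨f, -, rfl, hX, -⟩ := h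
  exact hX n le_rfl

theorem snoc (h : PathIn G X a b n) (hw : w ∉ X) (hb : G.Adj b w)
    (hX : ∀ x ∈ X, G.Adj x w → x = b) : PathIn G (insert w X) a w (n + 1) := by
  obtain ⟨f, h0, hn, hf, hp⟩ := h
  refine ⟨fun i => if i ≤ n then f i else w, by simpa using h0, by simp, ?_, ?_⟩
  · intro i hi
    by_cases hin : i ≤ n
    · simpa [hin] using Or.inr (hf i hin)
    · simp [hin]
  · intro i j hij hj
    by_cases hjn : j ≤ n
    · simpa [hjn, (hij.le.trans hjn)] using hp i j hij hjn
    · have hin : i ≤ n := by omega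
      simp only [hin, hjn, if_true, if_false]
      refine ⟨fun h => hw (h ▸ hf i hin), fun h => ?_, fun h => ?_⟩
      · have h1 := hX _ (hf i hin) h
        by_contra hne
        exact (hp i n (by omega) le_rfl).1 (h1.trans hn.symm)
      · have : i = n := by omega
        subst this
        rw [hn]
        exact hb

theorem append {v : ℕ → V} {m : ℕ} (h : PathIn G X a b n) (hv : IndPath G v m)
    (hb : G.Adj b (v 0)) (hX : ∀ j ≤ m, v j ∉ X)
    (hadj : ∀ j ≤ m, ∀ x ∈ X, G.Adj x (v j) → x = b ∧ j = 0) :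
    PathIn G (X ∪ {x | ∃ j ≤ m, x = v j}) a (v m) (n + m + 1) := by
  induction m with
  | zero =>
    obtain ⟨f, h1, h2, h3, h4⟩ := h.snoc (hX 0 le_rfl) hb fun x hx hxv => (hadj 0 le_rfl x hx hxv).1
    refine ⟨f, h1, h2, fun i hi => ?_, h4⟩
    rcases h3 i hi with h | h
    · exact Or.inr ⟨0, le_rfl, h⟩
    · exact Or.inl h
  | succ m ih =>
    have h5 := ih (hv.mono (Nat.le_succ m)) (fun j hj => hX j (by omega))
      fun j hj => hadj j (by omega)
    have h6 : v (m + 1) ∉ X ∪ {x | ∃ j ≤ m, x = v j} := by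
      rintro (h | ⟨j, hj, h⟩)
      · exact hX _ le_rfl h
      · exact (hv j (m + 1) (by omega) le_rfl).1 h.symm
    obtain ⟨f, h1, h2, h3, h4⟩ := h5.snoc h6 (hv.adj (Nat.lt_succ_self m)) (by
      rintro x (hx | ⟨j, hj, rfl⟩) hxv
      · exact absurd (hadj _ le_rfl x hx hxv).2 (by omega)
      · have := (hv j (m + 1) (by omega) le_rfl).2.1 hxv
        rw [Nat.succ.inj this])
    refine ⟨f, h1, h2, fun i hi => ?_, h4⟩
    rcases h3 i hi with h | h | ⟨j, hj, h⟩
    · exact Or.inr ⟨m + 1, le_rfl, h⟩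
    · exact Or.inl h
    · exact Or.inr ⟨j, by omega, h⟩

theorem cycle {v : V} (h : PathIn G X a b n) (hv : v ∉ X)
    (hadj : ∀ x ∈ X, G.Adj x v ↔ x = b ∨ x = a) : Nonempty (cycleGraph (n + 2) ↪g G) := by
  have ha := h.left_mem
  have hb := h.right_mem
  obtain ⟨f, h0, hn', hf, hp⟩ := h
  let g : ℕ → V := fun i => if i ≤ n then f i else v
  have hg : ∀ i j, i < j → j ≤ n + 1 →
      g i ≠ g j ∧ (G.Adj (g i) (g j) ↔ j = i + 1 ∨ (i = 0 ∧ j = n + 1)) := by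
    intro i j hij hj
    by_cases hjn : j ≤ n
    · have hin : i ≤ n := by omega
      simp only [g, hjn, hin, if_true]
      obtain ⟨h1, h2⟩ := hp i j hij hjn
      exact ⟨h1, h2.trans (by omega)⟩
    · have hin : i ≤ n := by omega
      have hj' : j = n + 1 := by omega
      simp only [g, hjn, hin, if_true, if_false]
      refine ⟨fun h => hv (h ▸ hf i hin), (hadj _ (hf i hin)).trans (or_congr ?_ ?_)⟩
      · rw [← hn']
        constructor
        · intro h
          by_contra hne
          exact (hp i n (by omega) le_rfl).1 h
        · intro h
          rw [show i = n by omega]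
      · rw [← h0]
        constructor
        · intro h
          by_contra hne
          exact (hp 0 i (by omega) hin).1 h.symm
        · intro h
          rw [h.1]
  have hadj' : ∀ i j : Fin (n + 2), i < j →
      ((cycleGraph (n + 2)).Adj i j ↔ G.Adj (g i) (g j)) := by
    intro i j hij
    have hij' : i.val < j.val := hij
    rw [(hg i j hij (by omega)).2, cycleGraph_adj', Fin.sub_val_of_le hij.le, Fin.coe_sub_iff_lt.2 hij]
    omega
  refine ⟨⟨⟨fun i => g i, ?_⟩, ?_⟩⟩
  · intro i j h
    rcases lt_trichotomy i j with hij | hij | hij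
    · exact absurd h (hg i j hij (by omega)).1
    · exact hij
    · exact absurd h.symm (hg j i hij (by omega)).1
  · intro i j
    show G.Adj (g i) (g j) ↔ _
    rcases lt_trichotomy i j with hij | rfl | hij
    · exact (hadj' i j hij).symm
    · simp
    · rw [adj_comm, ← hadj' j i hij, adj_comm]

end PathIn

/-- The properties of `G` that the construction uses: large sets contain large spheres of
radius `ρ`, balls of radius `ρ - 1` are `τ`-colourable, and sets that are not `τ`-colourable
contain a clique with no common neighbour. -/
structure Tame (φ : ℕ → ℕ) (ρ τ : ℕ) (G : SimpleGraph V) : Prop where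
  sphere : ∀ X N, ¬ ColorableOn G X (φ (τ + N)) → ∃ z ∈ X, ∃ B ⊆ X, ¬ ColorableOn G B N ∧
    ∀ b ∈ B, b ∉ walkBall G (ρ - 1) z ∧ ∃ t : ℕ → V, t 0 = z ∧ t ρ = b ∧
      (∀ j ≤ ρ, t j ∈ X) ∧ ∀ j < ρ, G.Adj (t j) (t (j + 1))
  ball : ∀ v, ColorableOn G (walkBall G (ρ - 1) v) τ
  clique : ∀ X, ¬ ColorableOn G X τ → ∃ K : Finset V, (K : Set V) ⊆ X ∧ G.IsClique K ∧
    ∀ x, ∃ k ∈ K, ¬ G.Adj k x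

theorem Tame.of_controlled {G : SimpleGraph V} [Fintype V] {φ : ℕ → ℕ} {ρ τ : ℕ}
    (hφ : Monotone φ) (hρ : 1 ≤ ρ) (hG : Controlled ρ φ G) (hτ : chiRho G (ρ - 1) ≤ (τ : ℕ∞))
    (hω : ∀ Y : Set V, (G.induce Y).cliqueNum < G.cliqueNum →
      (G.induce Y).chromaticNumber ≤ (τ : ℕ∞)) : Tame φ ρ τ G where
  ball v := by
    rw [colorableOn_iff, walkBall_eq_closedNbhd]
    exact (le_iSup (fun v => (G.induce (closedNbhd G v (ρ - 1))).chromaticNumber) v).trans hτ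
  clique X hX := by
    classical
    rw [colorableOn_iff] at hX
    have h1 : G.cliqueNum ≤ (G.induce X).cliqueNum := not_lt.1 fun h => hX (hω X h)
    obtain ⟨K, hK⟩ := (G.induce X).exists_isNClique_cliqueNum
    refine ⟨K.map (Function.Embedding.subtype _), ?_, ?_, ?_⟩
    · intro x hx
      simp only [Finset.coe_map, Function.Embedding.subtype_apply, Set.mem_image] at hx
      obtain ⟨y, -, rfl⟩ := hx
      exact y.2
    · have := hK.isClique
      intro x hx y hy hxy
      simp only [Finset.coe_map, Function.Embedding.subtype_apply, Set.mem_image,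
        Finset.mem_coe] at hx hy
      obtain ⟨x, hx, rfl⟩ := hx
      obtain ⟨y, hy, rfl⟩ := hy
      exact this hx hy fun h => hxy (congrArg _ h)
    · intro x
      by_contra! hx
      have hK' : G.IsClique (K.map (Function.Embedding.subtype (· ∈ X)) : Finset V) := by
        intro x hx y hy hxy
        simp only [Finset.coe_map, Function.Embedding.subtype_apply, Set.mem_image,
          Finset.mem_coe] at hx hy
        obtain ⟨x, hx, rfl⟩ := hx
        obtain ⟨y, hy, rfl⟩ := hy
        exact hK.isClique hx hy fun h => hxy (congrArg _ h)
      have hins : G.IsNClique ((G.induce X).cliqueNum + 1)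
          (insert x (K.map (Function.Embedding.subtype (· ∈ X)))) := by
        refine IsNClique.insert ⟨hK', ?_⟩ fun b hb => (hx b hb).symm
        rw [Finset.card_map, hK.card_eq]
      have := hins.isClique.card_le_cliqueNum
      rw [hins.card_eq] at this
      omega
  sphere X N hX := by
    rw [colorableOn_iff, not_le] at hX
    have h1 : φ (τ + N) < φ (chiRho (G.induce X) ρ).toNat := by
      exact_mod_cast hX.trans_le (hG X)
    have h2 : τ + N < (chiRho (G.induce X) ρ).toNat := lt_of_not_ge fun h => h1.not_ge (hφ h)
    have h3 : ∃ z : X, ¬ ((G.induce X).induce (closedNbhd (G.induce X) z ρ)).chromaticNumber ≤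
        ((τ + N : ℕ) : ℕ∞) := by
      by_contra! h
      have h4 : chiRho (G.induce X) ρ ≤ ((τ + N : ℕ) : ℕ∞) := iSup_le h
      have h5 := ENat.toNat_le_toNat h4 (ENat.natCast_ne_top _)
      rw [ENat.toNat_natCast] at h5
      omega
    obtain ⟨z, hz⟩ := h3
    rw [← colorableOn_iff, ← walkBall_eq_closedNbhd] at hz
    refine ⟨z, z.2, (Subtype.val '' walkBall (G.induce X) ρ z) \ walkBall G (ρ - 1) z, ?_, ?_, ?_⟩
    · rintro _ ⟨⟨b, -, rfl⟩, -⟩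
      exact b.2
    · intro hN
      have hτz : ColorableOn G (walkBall G (ρ - 1) z) τ := by
        rw [colorableOn_iff, walkBall_eq_closedNbhd]
        exact (le_iSup (fun v => (G.induce (closedNbhd G v (ρ - 1))).chromaticNumber) _).trans hτ
      obtain ⟨f, hf, hfa⟩ := hτz.union (X := Subtype.val '' walkBall (G.induce X) ρ z) hN
        fun b hb => or_iff_not_imp_left.2 fun h => ⟨hb, h⟩
      exact hz ⟨fun v => f v, fun v hv => hf v ⟨v, hv, rfl⟩,
        fun u hu v hv huv => hfa u ⟨u, hu, rfl⟩ v ⟨v, hv, rfl⟩ huv⟩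
    · rintro _ ⟨⟨b, ⟨p, hp⟩, rfl⟩, hb⟩
      have hl : p.length = ρ := by
        by_contra hne
        refine hb ⟨p.map (Embedding.induce X).toHom, ?_⟩
        have := Walk.length_map (Embedding.induce X).toHom p
        exact this.trans_le (by omega)
      refine ⟨hb, fun j => (p.getVert j : V), by simp, ?_, fun j _ => (p.getVert j).2,
        fun j hj => p.adj_getVert_succ (by omega)⟩
      exact congrArg Subtype.val (hl ▸ p.getVert_length)

/-- The vertices at distance exactly `ρ` from `o`. -/
def layer (G : SimpleGraph V) (ρ : ℕ) (o : V) : Set V :=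
  walkBall G ρ o \ walkBall G (ρ - 1) o

/-- Inside `F` there are induced paths from `q` of each of the lengths `lam, …, lam + n`, such
that exactly the last vertex is adjacent to `c`, and such that only `q` is close to `o`. -/
def Linked (G : SimpleGraph V) (F : Set V) (o q : V) (n lam : ℕ) (c : V) : Prop :=
  ∀ i ≤ n, ∃ X ⊆ F, ∃ f ∈ X, PathIn G X q f (lam + i) ∧ (∀ x ∈ X, G.Adj x c ↔ x = f) ∧
    ∀ x ∈ X, x = q ∨ x ∉ walkBall G 2 o

/-- From the hub `p` each vertex of `B` can be reached through the layer of `o`, in such a way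
that `Linked` holds at the first step; all vertices of `F` are far away from `B`. -/
def HasLinks (G : SimpleGraph V) (ρ : ℕ) (o d q : V) (n lam : ℕ) (B : Set V) : Prop :=
  ∃ F : Set V, ∃ p ∈ F, o ∈ F ∧ d ∈ F ∧ q ∈ F ∧ ∀ b ∈ B, b ∈ layer G ρ o ∧
    (∀ f ∈ F, b ∉ walkBall G (ρ - 1) f) ∧ ∃ t : ℕ → V, t 0 = p ∧ t ρ = b ∧
      (∀ j < ρ, G.Adj (t j) (t (j + 1))) ∧ (∀ j, 1 ≤ j → j ≤ ρ → t j ∈ layer G ρ o) ∧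
      Linked G F o q n lam (t 1)

theorem exists_chain_of_mem_layer {G : SimpleGraph V} {ρ : ℕ} {o b : V} (h : b ∈ layer G ρ o) :
    ∃ u : ℕ → V, u 0 = b ∧ u ρ = o ∧ ∀ j < ρ, G.Adj (u j) (u (j + 1)) := by
  obtain ⟨⟨p, hp⟩, hb⟩ := h
  have hl : p.length = ρ := by
    by_contra hne
    exact hb ⟨p, by omega⟩
  refine ⟨fun j => p.reverse.getVert j, by simp, ?_, fun j hj => ?_⟩
  · have := p.reverse.getVert_length
    rwa [Walk.length_reverse, hl] at this
  · exact p.reverse.adj_getVert_succ (by simpa [hl] using hj)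

/-- Closing the paths of `HasLinks` to cycles through a shortest path from `b` to `o`. -/
theorem HasLinks.exists_cycles {G : SimpleGraph V} {ρ n lam : ℕ} {o d q b : V} {B : Set V}
    (hρ : 3 ≤ ρ) (hod : G.Adj o d) (hdq : G.Adj d q) (hoq : ¬ G.Adj o q) (hne : o ≠ q)
    (h : HasLinks G ρ o d q n lam B) (hb : b ∈ B) :
    ∃ s ≤ 2, ∃ j, 1 ≤ j ∧ j ≤ ρ ∧
      ∀ i ≤ n, Nonempty (cycleGraph (lam + i + j + ρ + s) ↪g G) := by
  classical
  obtain ⟨F, p, hp, ho, hd, hq, hB⟩ := h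
  obtain ⟨hbL, hfar, t, ht0, htρ, hta, htL, hlink⟩ := hB b hb
  obtain ⟨u, hu0, huρ, hua⟩ := exists_chain_of_mem_layer hbL
  have hut : ∀ k, 1 ≤ k → k ≤ ρ → u k ∈ walkBall G (ρ - k) o := fun k h1 h2 =>
    walkBall_symm (huρ ▸ chain_mem_walkBall' hua h2 le_rfl (by omega))
  have hub : ∀ k ≤ ρ, b ∈ walkBall G k (u k) := fun k h2 =>
    walkBall_symm (hu0 ▸ chain_mem_walkBall' hua (Nat.zero_le k) h2 (by omega))
  have htb : ∀ k, k ≤ ρ → b ∈ walkBall G (ρ - k) (t k) := fun k h2 =>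
    htρ ▸ chain_mem_walkBall' hta h2 le_rfl (by omega)
  have hui : IndPath G u ρ := by
    refine IndPath.of_geodesic hua ?_
    rw [hu0, huρ]
    exact fun h => hbL.2 (walkBall_symm h)
  have hti : IndPath G t ρ := by
    refine IndPath.of_geodesic hta ?_
    rw [ht0, htρ]
    exact hfar p hp
  -- vertices of `F` and the two chains
  have hFt : ∀ x ∈ F, ∀ k, 1 ≤ k → k ≤ ρ → x ≠ t k := by
    rintro x hx k h1 h2 rfl
    exact hfar _ hx (walkBall_mono (htb k h2) (by omega))
  have hFta : ∀ x ∈ F, ∀ k, 2 ≤ k → k ≤ ρ → ¬ G.Adj x (t k) := by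
    intro x hx k h1 h2 hadj
    exact hfar _ hx (walkBall_mono (walkBall_trans (adj_mem_walkBall hadj le_rfl) (htb k h2))
      (by omega))
  have hFu : ∀ x ∈ F, ∀ k, k < ρ → x ≠ u k := by
    rintro x hx k h2 rfl
    exact hfar _ hx (walkBall_mono (hub k h2.le) (by omega))
  have hFua : ∀ x ∈ F, ∀ k, k + 1 < ρ → ¬ G.Adj x (u k) := by
    intro x hx k h2 hadj
    exact hfar _ hx (walkBall_mono (walkBall_trans (adj_mem_walkBall hadj le_rfl)
      (hub k (by omega))) (by omega))
  have htu : ∀ k, 1 ≤ k → k ≤ ρ → ∀ j, 1 ≤ j → j ≤ ρ → t j ≠ u k := by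
    intro k h1 h2 j h3 h4 heq
    exact (htL j h3 h4).2 (walkBall_mono (heq ▸ hut k h1 h2) (by omega))
  have htua : ∀ k, 2 ≤ k → k ≤ ρ → ∀ j, 1 ≤ j → j ≤ ρ → ¬ G.Adj (t j) (u k) := by
    intro k h1 h2 j h3 h4 hadj
    exact (htL j h3 h4).2 (walkBall_mono (walkBall_adj (hut k (by omega) h2) hadj.symm)
      (by omega))
  have hex : ∃ j, 1 ≤ j ∧ G.Adj (t j) (u 1) :=
    ⟨ρ, by omega, by rw [htρ, ← hu0]; exact hua 0 (by omega)⟩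
  let j := Nat.find hex
  have hj1 : 1 ≤ j := (Nat.find_spec hex).1
  have hja : G.Adj (t j) (u 1) := (Nat.find_spec hex).2
  have hjρ : j ≤ ρ := Nat.find_min' hex ⟨by omega, by
    rw [htρ, ← hu0]; exact hua 0 (by omega)⟩
  have hjmin : ∀ k, 1 ≤ k → k < j → ¬ G.Adj (t k) (u 1) := fun k h1 h2 h3 =>
    Nat.find_min hex h2 ⟨h1, h3⟩
  have hu1o : G.Adj (u (ρ - 1)) o := by
    have := hua (ρ - 1) (by omega)
    rwa [show ρ - 1 + 1 = ρ by omega, huρ] at this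
  have hdo : d ∈ walkBall G 1 o := adj_mem_walkBall hod le_rfl
  have hXu : ∀ X ⊆ F, (∀ x ∈ X, x = q ∨ x ∉ walkBall G 2 o) → ∀ x ∈ X, ∀ k, k < ρ →
      G.Adj x (u k) → k = ρ - 1 ∧ x = q := by
    intro X hXF hX x hx k hk hadj
    have hk' : k = ρ - 1 := by
      by_contra hne'
      exact hFua x (hXF hx) k (by omega) hadj
    subst hk'
    exact ⟨rfl, (hX x hx).resolve_right (not_not.2
      (walkBall_adj (adj_mem_walkBall hu1o.symm le_rfl) hadj.symm))⟩
  -- the path up to `u m`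
  have hpath : ∀ m, 1 ≤ m → m < ρ → (m = ρ - 1 → ¬ G.Adj q (u (ρ - 1))) → ∀ i ≤ n,
      ∃ X ⊆ F, (∀ x ∈ X, x = q ∨ x ∉ walkBall G 2 o) ∧
      PathIn G (X ∪ {x | ∃ k, 1 ≤ k ∧ k ≤ j ∧ x = t k} ∪ {x | ∃ k, 1 ≤ k ∧ k ≤ m ∧ x = u k}) q
        (u m) (lam + i + j + m) := by
    intro m hm1 hmρ hmq i hi
    obtain ⟨X, hXF, f, hf, hpath, hXc, hXo⟩ := hlink i hi
    refine ⟨X, hXF, hXo, ?_⟩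
    have h1 : PathIn G (X ∪ {x | ∃ k, 1 ≤ k ∧ k ≤ j ∧ x = t k}) q (t j) (lam + i + j) := by
      have h2 := hpath.append (v := fun k => t (1 + k)) (m := j - 1) (hti.shift (by omega))
        ((hXc f hf).2 rfl) (fun k hk hx => hFt _ (hXF hx) (1 + k) (by omega) (by omega) rfl)
        (fun k hk x hx hadj => by
          have hk0 : k = 0 := by
            by_contra hk0
            exact hFta x (hXF hx) (1 + k) (by omega) (by omega) hadj
          subst hk0
          exact ⟨(hXc x hx).1 hadj, rfl⟩)
      obtain ⟨g, h3, h4, h5, h6⟩ := h2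
      rw [show lam + i + (j - 1) + 1 = lam + i + j by omega] at h4 h5 h6
      rw [show 1 + (j - 1) = j by omega] at h4
      refine ⟨g, h3, h4, fun k hk => (h5 k hk).imp_right ?_, h6⟩
      rintro ⟨l, hl, h⟩
      exact ⟨1 + l, by omega, by omega, h⟩
    have h2 := h1.append (v := fun k => u (1 + k)) (m := m - 1) (hui.shift (by omega)) hja
      (by
        rintro k hk (hx | ⟨l, hl1, hl2, hx⟩)
        · exact hFu _ (hXF hx) (1 + k) (by omega) rfl
        · exact htu (1 + k) (by omega) (by omega) l hl1 (by omega) hx.symm)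
      (by
        rintro k hk x (hx | ⟨l, hl1, hl2, rfl⟩) hadj
        · obtain ⟨h3, rfl⟩ := hXu X hXF hXo x hx (1 + k) (by omega) hadj
          rw [h3] at hadj
          exact absurd hadj (hmq (by omega))
        · have hk0 : k = 0 := by
            by_contra hk0
            exact htua (1 + k) (by omega) (by omega) l hl1 (by omega) hadj
          subst hk0
          refine ⟨?_, rfl⟩
          rcases hl2.lt_or_eq with h | rfl
          · exact absurd hadj (hjmin l hl1 h)
          · rfl)
    obtain ⟨g, h3, h4, h5, h6⟩ := h2
    rw [show lam + i + j + (m - 1) + 1 = lam + i + j + m by omega] at h4 h5 h6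
    rw [show 1 + (m - 1) = m by omega] at h4
    refine ⟨g, h3, h4, fun k hk => (h5 k hk).imp_right ?_, h6⟩
    rintro ⟨l, hl, h⟩
    exact ⟨1 + l, by omega, by omega, h⟩
  by_cases hq' : G.Adj q (u (ρ - 1))
  · refine ⟨0, by omega, j, hj1, hjρ, fun i hi => ?_⟩
    obtain ⟨X, hXF, hXo, hX⟩ := hpath (ρ - 2) (by omega) (by omega) (by omega) i hi
    have := hX.cycle (v := u (ρ - 1)) (by
      rintro ((hx | ⟨k, hk1, hk2, hx⟩) | ⟨k, hk1, hk2, hx⟩)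
      · exact hFu _ (hXF hx) _ (by omega) rfl
      · exact htu _ (by omega) (by omega) k hk1 (by omega) hx.symm
      · exact (hui k (ρ - 1) (by omega) (by omega)).1 hx.symm) (by
      rintro x hx
      constructor
      · intro hadj
        rcases hx with (hx | ⟨k, hk1, hk2, rfl⟩) | ⟨k, hk1, hk2, rfl⟩
        · exact Or.inr (hXu X hXF hXo x hx _ (by omega) hadj).2
        · exact absurd hadj (htua _ (by omega) (by omega) k hk1 (by omega))
        · have := (hui k (ρ - 1) (by omega) (by omega)).2.1 hadj
          rw [show k = ρ - 2 by omega]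
          exact Or.inl rfl
      · rintro (rfl | rfl)
        · have := hua (ρ - 2) (by omega)
          rwa [show ρ - 2 + 1 = ρ - 1 by omega] at this
        · exact hq')
    rwa [show lam + i + j + (ρ - 2) + 2 = lam + i + j + ρ + 0 by omega] at this
  have hpath' := hpath (ρ - 1) (by omega) (by omega) fun _ => hq'
  have hdnot : ∀ X ⊆ F, (∀ x ∈ X, x = q ∨ x ∉ walkBall G 2 o) →
      d ∉ X ∪ {x | ∃ k, 1 ≤ k ∧ k ≤ j ∧ x = t k} ∪ {x | ∃ k, 1 ≤ k ∧ k ≤ ρ - 1 ∧ x = u k} := by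
    rintro X hXF hXo ((hx | ⟨k, hk1, hk2, hx⟩) | ⟨k, hk1, hk2, hx⟩)
    · rcases hXo _ hx with h | h
      · exact hdq.ne h
      · exact h (walkBall_mono hdo (by omega))
    · exact (htL k hk1 (by omega)).2 (hx ▸ walkBall_mono hdo (by omega))
    · exact hFu _ hd k (by omega) hx
  have hdadj : ∀ X ⊆ F, (∀ x ∈ X, x = q ∨ x ∉ walkBall G 2 o) →
      ∀ x ∈ X ∪ {x | ∃ k, 1 ≤ k ∧ k ≤ j ∧ x = t k} ∪ {x | ∃ k, 1 ≤ k ∧ k ≤ ρ - 1 ∧ x = u k},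
      G.Adj x d → x = u (ρ - 1) ∨ x = q := by
    rintro X hXF hXo x ((hx | ⟨k, hk1, hk2, rfl⟩) | ⟨k, hk1, hk2, rfl⟩) hadj
    · exact Or.inr ((hXo _ hx).resolve_right (not_not.2 (walkBall_adj hdo hadj.symm)))
    · exact absurd (walkBall_mono (walkBall_adj hdo hadj.symm) (by omega))
        (htL k hk1 (by omega)).2
    · by_cases hk : k = ρ - 1
      · exact Or.inl (by rw [hk])
      · exact absurd hadj.symm (hFua _ hd k (by omega))
  by_cases hd' : G.Adj d (u (ρ - 1))
  · refine ⟨1, by omega, j, hj1, hjρ, fun i hi => ?_⟩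
    obtain ⟨X, hXF, hXo, hX⟩ := hpath' i hi
    have := hX.cycle (v := d) (hdnot X hXF hXo) (fun x hx => ⟨hdadj X hXF hXo x hx, by
      rintro (rfl | rfl)
      · exact hd'.symm
      · exact hdq.symm⟩)
    rwa [show lam + i + j + (ρ - 1) + 2 = lam + i + j + ρ + 1 by omega] at this
  · refine ⟨2, by omega, j, hj1, hjρ, fun i hi => ?_⟩
    obtain ⟨X, hXF, hXo, hX⟩ := hpath' i hi
    have h1 := hX.snoc (w := o) (by
      rintro ((hx | ⟨k, hk1, hk2, hx⟩) | ⟨k, hk1, hk2, hx⟩)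
      · exact (hXo _ hx).elim hne fun h => h self_mem_walkBall
      · exact (htL k hk1 (by omega)).2 (hx ▸ self_mem_walkBall)
      · exact hFu _ ho k (by omega) hx) hu1o (by
      rintro x ((hx | ⟨k, hk1, hk2, rfl⟩) | ⟨k, hk1, hk2, rfl⟩) hadj
      · rcases hXo _ hx with rfl | h
        · exact absurd hadj.symm hoq
        · exact absurd (adj_mem_walkBall hadj.symm (by omega)) h
      · exact absurd (adj_mem_walkBall hadj.symm (by omega)) (htL k hk1 (by omega)).2
      · by_cases hk : k = ρ - 1
        · rw [hk]
        · exact absurd hadj.symm (hFua _ ho k (by omega)))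
    have := h1.cycle (v := d) (by
      rintro (h | h)
      · exact hod.ne h.symm
      · exact hdnot X hXF hXo h) (by
      intro x hx
      constructor
      · intro hadj
        rcases hx with rfl | hx
        · exact Or.inl rfl
        · rcases hdadj X hXF hXo x hx hadj with rfl | h
          · exact absurd hadj.symm hd'
          · exact Or.inr h
      · rintro (rfl | rfl)
        · exact hod
        · exact hdq.symm)
    rwa [show lam + i + j + (ρ - 1) + 1 + 2 = lam + i + j + ρ + 2 by omega] at this

theorem Tame.not_colorableOn_diff {G : SimpleGraph V} {φ : ℕ → ℕ} {ρ τ s N : ℕ}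
    (hG : Tame φ ρ τ G) (T : Finset V) (hT : T.card ≤ s) {B : Set V}
    (hB : ¬ ColorableOn G B (s * τ + N)) :
    ¬ ColorableOn G {b ∈ B | ∀ x ∈ T, b ∉ walkBall G (ρ - 1) x} N := by
  have h1 : ColorableOn G {b ∈ B | ∃ x ∈ T, b ∈ walkBall G (ρ - 1) x} (s * τ) :=
    (ColorableOn.of_cover T (walkBall G (ρ - 1)) τ (fun v hv => hv.2) fun k _ =>
      (hG.ball k).mono Set.inter_subset_right le_rfl).mono subset_rfl
      (Nat.mul_le_mul_right τ hT)
  refine not_colorableOn_of_cover hB h1 fun b hb => ?_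
  by_cases h : ∃ x ∈ T, b ∈ walkBall G (ρ - 1) x
  · exact Or.inl ⟨hb, h⟩
  · exact Or.inr ⟨hb, by simpa using h⟩

theorem Tame.card_le_of_isClique {G : SimpleGraph V} {φ : ℕ → ℕ} {ρ τ : ℕ}
    (hG : Tame φ ρ τ G) (hρ : 2 ≤ ρ) {K : Finset V} (hK : G.IsClique K) : K.card ≤ τ := by
  rcases K.eq_empty_or_nonempty with rfl | ⟨w, hw⟩
  · simp
  obtain ⟨f, hf, hfa⟩ := hG.ball w
  have hmem : ∀ k ∈ K, k ∈ walkBall G (ρ - 1) w := fun k hk => by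
    by_cases h : w = k
    · rw [h]
      exact self_mem_walkBall
    · exact adj_mem_walkBall (hK hw hk h) (by omega)
  have := Finset.card_le_card_of_injOn f (s := K) (t := Finset.range τ)
    (fun k hk => by simpa using hf k (hmem k hk)) fun a ha b hb hab => by
      by_contra hne
      exact hfa a (hmem a ha) b (hmem b hb) (hK ha hb hne) hab
  simpa using this

/-- Inside `F` there are induced paths from `q` to `r` of each of the lengths `L, …, L + n`,
such that only `r` may have neighbours in `Y` and only `q` is close to `o`. -/
def IsEntry (G : SimpleGraph V) (F Y : Set V) (o q r : V) (n L : ℕ) : Prop :=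
  ∀ i ≤ n, ∃ X ⊆ F, PathIn G X q r (L + i) ∧ (∀ x ∈ X, x = q ∨ x ∉ walkBall G 2 o) ∧
    ∀ x ∈ X, ∀ y ∈ Y, x ≠ y ∧ (G.Adj x y → x = r)

/-- Each `y ∈ Y` has an entry `e y`, and these are ordered by `cls` in such a way that `e y` is
the first entry adjacent to `y`. -/
structure Rooted (G : SimpleGraph V) (ρ : ℕ) (o q : V) (n L : ℕ) (F Y : Set V) (e : V → V)
    (cls : V → ℕ) : Prop where
  layer : ∀ y ∈ Y, y ∈ layer G ρ o
  far : ∀ y ∈ Y, ∀ f ∈ F, y ∉ walkBall G (ρ - 1) f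
  adj : ∀ y ∈ Y, G.Adj (e y) y
  inj : ∀ y ∈ Y, ∀ y' ∈ Y, cls y = cls y' → e y = e y'
  le : ∀ y ∈ Y, ∀ y' ∈ Y, G.Adj (e y) y' → cls y' ≤ cls y
  entry : ∀ y ∈ Y, ∃ T : Finset V, T.card ≤ ρ ∧ IsEntry G (F ∪ T) Y o q (e y) n L

theorem HasLinks.exists_rooted [Finite V] {G : SimpleGraph V} {ρ n lam : ℕ} {o d q : V}
    {B : Set V} (hρ : 3 ≤ ρ) (h : HasLinks G ρ o d q n lam B) :
    ∃ F e cls, o ∈ F ∧ d ∈ F ∧ q ∈ F ∧ Rooted G ρ o q n (lam + ρ - 1) F B e cls := by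
  classical
  obtain ⟨F, p, hp, ho, hd, hq, hB⟩ := h
  have hB' : ∀ b, ∃ t : ℕ → V, b ∈ B → t 0 = p ∧ t ρ = b ∧
      (∀ j < ρ, G.Adj (t j) (t (j + 1))) ∧ (∀ j, 1 ≤ j → j ≤ ρ → t j ∈ layer G ρ o) ∧
      Linked G F o q n lam (t 1) := fun b => by
    by_cases hb : b ∈ B
    · obtain ⟨-, -, t, ht⟩ := hB b hb
      exact ⟨t, fun _ => ht⟩
    · exact ⟨fun _ => p, fun h => (hb h).elim⟩
  choose t ht using hB'
  obtain ⟨ι, hι⟩ : ∃ ι : V → ℕ, Function.Injective ι := by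
    obtain ⟨N, ⟨f⟩⟩ := Finite.exists_equiv_fin V
    exact ⟨fun v => f v, Fin.val_injective.comp f.injective⟩
  have hlast : ∀ b ∈ B, G.Adj (t b (ρ - 1)) b := fun b hb => by
    obtain ⟨-, h1, h2, -⟩ := ht b hb
    have := h2 (ρ - 1) (by omega)
    rwa [show ρ - 1 + 1 = ρ by omega, h1] at this
  have hmin : ∀ y, ∃ r, y ∈ B → (∃ b ∈ B, r = t b (ρ - 1)) ∧ G.Adj r y ∧
      ∀ b ∈ B, G.Adj (t b (ρ - 1)) y → ι r ≤ ι (t b (ρ - 1)) := fun y => by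
    by_cases hy : y ∈ B
    · obtain ⟨r, ⟨h1, h2⟩, h3⟩ := Set.exists_min_image {r | (∃ b ∈ B, r = t b (ρ - 1)) ∧ G.Adj r y}
        ι (Set.toFinite _) ⟨_, ⟨y, hy, rfl⟩, hlast y hy⟩
      exact ⟨r, fun _ => ⟨h1, h2, fun b hb hadj => h3 _ ⟨⟨b, hb, rfl⟩, hadj⟩⟩⟩
    · exact ⟨y, fun h => (hy h).elim⟩
  choose e he using hmin
  refine ⟨F, e, fun y => ι (e y), ho, hd, hq, fun y hy => (hB y hy).1,
    fun y hy => (hB y hy).2.1, fun y hy => (he y hy).2.1, fun y _ y' _ h => hι h, ?_, ?_⟩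
  · intro y hy y' hy' hadj
    obtain ⟨b, hb, hr⟩ := (he y hy).1
    have := (he y' hy').2.2 b hb (hr ▸ hadj)
    rwa [← hr] at this
  · intro y hy
    obtain ⟨b, hb, hr⟩ := (he y hy).1
    rw [hr]
    obtain ⟨ht0, htρ, hta, htL, hlink⟩ := ht b hb
    have hti : IndPath G (t b) ρ := by
      refine IndPath.of_geodesic hta ?_
      rw [ht0, htρ]
      exact (hB b hb).2.1 p hp
    refine ⟨(Finset.Icc 1 (ρ - 1)).image (t b), Finset.card_image_le.trans (by simp), ?_⟩
    intro i hi
    obtain ⟨X, hXF, f, hf, hpath, hXc, hXo⟩ := hlink i hi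
    have htb : ∀ k, k ≤ ρ → b ∈ walkBall G (ρ - k) (t b k) := fun k h2 => by
      have := chain_mem_walkBall' hta h2 le_rfl (d := ρ - k) (by omega)
      rwa [htρ] at this
    have htp : ∀ k, k ≤ ρ → t b k ∈ walkBall G k p := fun k h2 => by
      have := chain_mem_walkBall' hta (Nat.zero_le k) h2 (d := k) (by omega)
      rwa [ht0] at this
    have h1 := hpath.append (v := fun k => t b (1 + k)) (m := ρ - 2) (hti.shift (by omega))
      ((hXc f hf).2 rfl) (fun k hk hx =>
        (hB b hb).2.1 _ (hXF hx) (walkBall_mono (htb (1 + k) (by omega)) (by omega)))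
      (fun k hk x hx hadj => by
        have hk0 : k = 0 := by
          by_contra hk0
          exact (hB b hb).2.1 _ (hXF hx) (walkBall_mono (walkBall_trans
            (adj_mem_walkBall hadj le_rfl) (htb (1 + k) (by omega))) (by omega))
        subst hk0
        exact ⟨(hXc x hx).1 hadj, rfl⟩)
    rw [show lam + i + (ρ - 2) + 1 = lam + ρ - 1 + i by omega,
      show 1 + (ρ - 2) = ρ - 1 by omega] at h1
    refine ⟨_, ?_, h1, ?_, ?_⟩
    · rintro x (hx | ⟨k, hk, rfl⟩)
      · exact Or.inl (hXF hx)
      · refine Or.inr ?_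
        simp only [Finset.coe_image, Set.mem_image, Finset.coe_Icc, Set.mem_Icc]
        exact ⟨1 + k, by omega, rfl⟩
    · rintro x (hx | ⟨k, hk, rfl⟩)
      · exact hXo x hx
      · exact Or.inr fun h => (htL (1 + k) (by omega) (by omega)).2 (walkBall_mono h (by omega))
    · rintro x (hx | ⟨k, hk, rfl⟩) y' hy'
      · refine ⟨fun h => (hB y' hy').2.1 x (hXF hx) (h ▸ self_mem_walkBall), fun h => ?_⟩
        exact absurd (adj_mem_walkBall h (by omega)) ((hB y' hy').2.1 x (hXF hx))
      · refine ⟨fun h => (hB y' hy').2.1 p hp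
          (h ▸ walkBall_mono (htp (1 + k) (by omega)) (by omega)), fun h => ?_⟩
        by_cases hk' : k = ρ - 2
        · rw [hk', show 1 + (ρ - 2) = ρ - 1 by omega]
        · exact absurd (walkBall_mono (walkBall_adj (htp (1 + k) (by omega)) h) (by omega))
            ((hB y' hy').2.1 p hp)

theorem IsEntry.extend {G : SimpleGraph V} {ρ n L m : ℕ} {F Y : Set V} {o q r c : V}
    {v : ℕ → V} (hρ : 3 ≤ ρ) (h : IsEntry G F Y o q r n L) (hY : ∀ y ∈ Y, y ∈ layer G ρ o)
    (hv : IndPath G v m) (hvY : ∀ j ≤ m, v j ∈ Y) (hr : G.Adj r (v 0))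
    (hr' : ∀ j, 1 ≤ j → j ≤ m → ¬ G.Adj r (v j)) (hc : c ∈ Y) (hcr : ¬ G.Adj r c)
    (hcv : ∀ j < m, ¬ G.Adj (v j) c) (hcm : G.Adj (v m) c) :
    Linked G (F ∪ {x | ∃ j ≤ m, x = v j}) o q n (L + m + 1) c := by
  intro i hi
  obtain ⟨X, hXF, hpath, hXo, hXY⟩ := h i hi
  have h1 := hpath.append hv hr (fun j hj hx => (hXY _ hx _ (hvY j hj)).1 rfl)
    fun j hj x hx hadj => by
      have hxr := (hXY x hx _ (hvY j hj)).2 hadj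
      refine ⟨hxr, ?_⟩
      by_contra hj0
      exact hr' j (by omega) hj (hxr ▸ hadj)
  rw [show L + i + m + 1 = L + m + 1 + i by omega] at h1
  refine ⟨_, ?_, _, h1.right_mem, h1, ?_, ?_⟩
  · exact Set.union_subset_union_left _ hXF
  · rintro x (hx | ⟨j, hj, rfl⟩)
    · refine iff_of_false (fun hadj => ?_) (hXY x hx _ (hvY m le_rfl)).1
      exact hcr ((hXY x hx c hc).2 hadj ▸ hadj)
    · rcases hj.lt_or_eq with h | rfl
      · exact iff_of_false (hcv j h) (hv j m h le_rfl).1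
      · exact iff_of_true hcm rfl
  · rintro x (hx | ⟨j, hj, rfl⟩)
    · exact hXo x hx
    · exact Or.inr fun h => (hY _ (hvY j hj)).2 (walkBall_mono h (by omega))

theorem Linked.mono {G : SimpleGraph V} {F F' : Set V} {o q c : V} {n lam : ℕ}
    (h : Linked G F o q n lam c) (hF : F ⊆ F') : Linked G F' o q n lam c := fun i hi => by
  obtain ⟨X, hX, h⟩ := h i hi
  exact ⟨X, hX.trans hF, h⟩

theorem Linked.succ {G : SimpleGraph V} {F : Set V} {o q c : V} {n lam : ℕ}
    (h : Linked G F o q n lam c) (h' : Linked G F o q n (lam + 1) c) :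
    Linked G F o q (n + 1) lam c := fun i hi => by
  by_cases hin : i ≤ n
  · exact h i hin
  · have := h' n le_rfl
    rwa [show lam + 1 + n = lam + i by omega] at this

/-- Two paths from entries to a common hub whose lengths differ by one. -/
theorem Rooted.hasLinks {G : SimpleGraph V} {φ : ℕ → ℕ} {ρ τ n L N m : ℕ} {o d q y y' : V}
    {F Y B : Set V} {e : V → V} {cls : V → ℕ} {v v' : ℕ → V} (hG : Tame φ ρ τ G) (hρ : 3 ≤ ρ)
    (hR : Rooted G ρ o q n L F Y e cls) (ho : o ∈ F) (hd : d ∈ F) (hq : q ∈ F) (hm : m ≤ ρ)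
    (hy : y ∈ Y) (hy' : y' ∈ Y) (hv : IndPath G v m) (hv' : IndPath G v' (m + 1))
    (hvY : ∀ j ≤ m, v j ∈ Y) (hvY' : ∀ j ≤ m + 1, v' j ∈ Y) (hub : v' (m + 1) = v m)
    (hr : G.Adj (e y) (v 0)) (hr' : G.Adj (e y') (v' 0))
    (hrn : ∀ j, 1 ≤ j → j ≤ m → ¬ G.Adj (e y) (v j))
    (hrn' : ∀ j, 1 ≤ j → j ≤ m + 1 → ¬ G.Adj (e y') (v' j))
    (hB : ∀ b ∈ B, ∃ c : ℕ → V, c 0 = v m ∧ c ρ = b ∧ (∀ j < ρ, G.Adj (c j) (c (j + 1))) ∧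
      (∀ j ≤ ρ, c j ∈ Y) ∧ (∀ j < m, ¬ G.Adj (v j) (c 1)) ∧
      (∀ j < m + 1, ¬ G.Adj (v' j) (c 1)) ∧ ¬ G.Adj (e y) (c 1) ∧ ¬ G.Adj (e y') (c 1))
    (hN : ¬ ColorableOn G B ((4 * ρ + 3) * τ + N)) :
    ∃ B' ⊆ B, ¬ ColorableOn G B' N ∧ HasLinks G ρ o d q (n + 1) (L + m + 1) B' := by
  classical
  obtain ⟨T, hTc, hT⟩ := hR.entry y hy
  obtain ⟨T', hTc', hT'⟩ := hR.entry y' hy'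
  let S : Finset V := (Finset.range (m + 1)).image v
  let S' : Finset V := (Finset.range (m + 2)).image v'
  have hS : S.card ≤ m + 1 := Finset.card_image_le.trans (by simp)
  have hS' : S'.card ≤ m + 2 := Finset.card_image_le.trans (by simp)
  have hcard : (T ∪ T' ∪ S ∪ S').card ≤ 4 * ρ + 3 := by
    have h1 := Finset.card_union_le (T ∪ T' ∪ S) S'
    have h2 := Finset.card_union_le (T ∪ T') S
    have h3 := Finset.card_union_le T T'
    omega
  refine ⟨_, Set.sep_subset B _, hG.not_colorableOn_diff (T ∪ T' ∪ S ∪ S') hcard hN,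
    F ∪ (T ∪ T' ∪ S ∪ S' : Finset V), v m, Or.inr ?_, Or.inl ho, Or.inl hd, Or.inl hq, ?_⟩
  · simp only [Finset.coe_union]
    refine Or.inl (Or.inr ?_)
    exact Finset.mem_image_of_mem v (Finset.self_mem_range_succ m)
  rintro b ⟨hb, hfar⟩
  obtain ⟨c, hc0, hcρ, hca, hcY, hcv, hcv', hce, hce'⟩ := hB b hb
  have hbY : b ∈ Y := hcρ ▸ hcY ρ le_rfl
  refine ⟨hR.layer b hbY, ?_, c, hc0, hcρ, hca, fun j _ hj => hR.layer _ (hcY j hj), ?_⟩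
  · rintro f (hf | hf)
    · exact hR.far b hbY f hf
    · exact hfar f hf
  have hadj : G.Adj (v m) (c 1) := hc0 ▸ hca 0 (by omega)
  refine Linked.succ ?_ ?_
  · refine (hT.extend hρ hR.layer hv hvY hr hrn (hcY 1 (by omega)) hce hcv hadj).mono ?_
    rintro x ((hx | hx) | ⟨j, hj, rfl⟩)
    · exact Or.inl hx
    · simp only [Finset.coe_union]
      exact Or.inr (Or.inl (Or.inl (Or.inl hx)))
    · simp only [Finset.coe_union]
      exact Or.inr (Or.inl (Or.inr (Finset.mem_image_of_mem v (by simpa using by omega))))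
  · refine (hT'.extend hρ hR.layer hv' hvY' hr' hrn' (hcY 1 (by omega)) hce' hcv'
      (hub ▸ hadj)).mono ?_
    rintro x ((hx | hx) | ⟨j, hj, rfl⟩)
    · exact Or.inl hx
    · simp only [Finset.coe_union]
      exact Or.inr (Or.inl (Or.inl (Or.inr hx)))
    · simp only [Finset.coe_union]
      exact Or.inr (Or.inr (Finset.mem_image_of_mem v' (by simpa using by omega)))

/-- Each vertex of `B` is the end of a walk of length `ρ` from `h` in `Y` whose second vertex
satisfies `P`. -/
def HasWalks (G : SimpleGraph V) (ρ : ℕ) (Y B : Set V) (h : V) (P : V → Prop) : Prop :=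
  ∀ b ∈ B, ∃ c : ℕ → V, c 0 = h ∧ c ρ = b ∧ (∀ j < ρ, G.Adj (c j) (c (j + 1))) ∧
    (∀ j ≤ ρ, c j ∈ Y) ∧ P (c 1)

namespace Rooted

variable {G : SimpleGraph V} {φ : ℕ → ℕ} {ρ τ n L N : ℕ} {o d q : V}
  {F Y B : Set V} {e : V → V} {cls : V → ℕ}

/-- A pendant vertex `a` at the start of the path `x` gives a path that is longer by one. -/
theorem extend_pendant {m : ℕ} {a : V} {x : ℕ → V} (hG : Tame φ ρ τ G) (hρ : 3 ≤ ρ)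
    (hR : Rooted G ρ o q n L F Y e cls) (ho : o ∈ F) (hd : d ∈ F) (hq : q ∈ F) (hm : m ≤ ρ)
    (hx : IndPath G x m) (hxY : ∀ j ≤ m, x j ∈ Y) (ha : a ∈ Y) (hax : G.Adj a (x 0))
    (hax' : ∀ j, 1 ≤ j → j ≤ m → ¬ G.Adj a (x j))
    (he : ∀ j, 1 ≤ j → j ≤ m → ¬ G.Adj (e (x 0)) (x j))
    (hea : ∀ j ≤ m, ¬ G.Adj (e a) (x j))
    (hB : HasWalks G ρ Y B (x m) fun c => (∀ j < m, ¬ G.Adj (x j) c) ∧ ¬ G.Adj a c ∧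
      ¬ G.Adj (e (x 0)) c ∧ ¬ G.Adj (e a) c)
    (hN : ¬ ColorableOn G B ((4 * ρ + 3) * τ + N)) :
    ∃ B' ⊆ B, ¬ ColorableOn G B' N ∧ HasLinks G ρ o d q (n + 1) (L + m + 1) B' := by
  have hne : ∀ j ≤ m, a ≠ x j := fun j hj h => hea j hj (h ▸ hR.adj a ha)
  refine hR.hasLinks hG hρ ho hd hq hm (hxY 0 (Nat.zero_le m)) ha hx (hx.cons hax hne hax') hxY
    ?_ (by simp) (hR.adj _ (hxY 0 (Nat.zero_le m))) ?_ he ?_ ?_ hN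
  · intro j hj
    by_cases h : j = 0
    · simpa [h] using ha
    · simpa [h] using hxY (j - 1) (by omega)
  · simpa using hR.adj a ha
  · intro j hj1 hj
    simpa [show j ≠ 0 by omega] using hea (j - 1) (by omega)
  · intro b hb
    obtain ⟨c, h1, h2, h3, h4, h5, h6, h7, h8⟩ := hB b hb
    refine ⟨c, h1, h2, h3, h4, h5, fun j hj => ?_, h7, h8⟩
    by_cases h : j = 0
    · simpa [h] using h6
    · simpa [h] using h5 (j - 1) (by omega)

/-- A vertex `a` adjacent to `x 2` gives a shortcut of the path `x`. -/
theorem extend_shortcut {m : ℕ} {a : V} {x : ℕ → V} (hG : Tame φ ρ τ G) (hρ : 3 ≤ ρ)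
    (hR : Rooted G ρ o q n L F Y e cls) (ho : o ∈ F) (hd : d ∈ F) (hq : q ∈ F) (hm : m + 1 ≤ ρ)
    (hm1 : 1 ≤ m) (hx : IndPath G x (m + 1)) (hxY : ∀ j ≤ m + 1, x j ∈ Y) (ha : a ∈ Y)
    (hax : G.Adj a (x 2)) (hax' : ∀ j, 3 ≤ j → j ≤ m + 1 → ¬ G.Adj a (x j))
    (he : ∀ j, 1 ≤ j → j ≤ m + 1 → ¬ G.Adj (e (x 0)) (x j))
    (hea : ∀ j, 2 ≤ j → j ≤ m + 1 → ¬ G.Adj (e a) (x j))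
    (hB : HasWalks G ρ Y B (x (m + 1)) fun c => (∀ j < m + 1, ¬ G.Adj (x j) c) ∧ ¬ G.Adj a c ∧
      ¬ G.Adj (e (x 0)) c ∧ ¬ G.Adj (e a) c)
    (hN : ¬ ColorableOn G B ((4 * ρ + 3) * τ + N)) :
    ∃ B' ⊆ B, ¬ ColorableOn G B' N ∧ HasLinks G ρ o d q (n + 1) (L + m + 1) B' := by
  obtain ⟨m, rfl⟩ := Nat.exists_eq_add_of_le' hm1
  have hne : ∀ j ≤ m, a ≠ x (2 + j) := fun j hj h => hea (2 + j) (by omega) (by omega)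
    (h ▸ hR.adj a ha)
  have hsh := (hx.shift (a := 2) (n := m) (by omega)).cons hax hne fun j h1 h2 =>
    hax' (2 + j) (by omega) (by omega)
  have hcast : ∀ j ≠ 0, 2 + (j - 1) = j + 1 := fun j hj => by omega
  have hlast : ∀ v : ℕ → V, (if m + 1 = 0 then a else v (2 + (m + 1 - 1))) = v (m + 1 + 1) :=
    fun v => by rw [if_neg (by omega)]; congr 1; omega
  refine hR.hasLinks hG hρ ho hd hq (by omega) ha (hxY 0 (Nat.zero_le _)) hsh hx ?_ hxY
    (hlast x).symm ?_ (hR.adj _ (hxY 0 (Nat.zero_le _))) ?_ he ?_ hN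
  · intro j hj
    by_cases h : j = 0
    · simpa [h] using ha
    · simpa [h] using hxY (2 + (j - 1)) (by omega)
  · simpa using hR.adj a ha
  · intro j hj1 hj
    simpa [show j ≠ 0 by omega] using hea (2 + (j - 1)) (by omega) (by omega)
  · intro b hb
    obtain ⟨c, h1, h2, h3, h4, h5, h6, h7, h8⟩ := hB b hb
    refine ⟨c, h1.trans (hlast x).symm, h2, h3, h4, fun j hj => ?_, h5, h8, h7⟩
    by_cases h : j = 0
    · simpa [h] using h6
    · simpa [h] using h5 (2 + (j - 1)) (by omega)

end Rooted

/-- The vertices of `X` that come last in a clique of `X` without common neighbours. -/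
def lastInClique (G : SimpleGraph V) (cls : V → ℕ) (X : Set V) : Set V :=
  {y ∈ X | ∃ K : Finset V, (K : Set V) ⊆ X ∧ G.IsClique K ∧ (∀ x, ∃ k ∈ K, ¬ G.Adj k x) ∧
    y ∈ K ∧ ∀ k ∈ K, cls k ≤ cls y}

theorem Tame.not_colorableOn_lastInClique {G : SimpleGraph V} {φ : ℕ → ℕ} {ρ τ N : ℕ} [Nonempty V]
    (hG : Tame φ ρ τ G) (cls : V → ℕ) {X : Set V} (hX : ¬ ColorableOn G X (τ + N)) :
    ¬ ColorableOn G (lastInClique G cls X) N := by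
  refine not_colorableOn_of_cover (Y := X \ lastInClique G cls X) hX ?_ fun x hx =>
    or_iff_not_imp_right.2 fun h => ⟨hx, h⟩
  by_contra h
  obtain ⟨K, hKX, hK, hKn⟩ := hG.clique _ h
  obtain ⟨k, hk, -⟩ := hKn (Classical.arbitrary V)
  obtain ⟨y, hy, hmax⟩ := K.exists_max_image cls ⟨k, hk⟩
  exact (hKX hy).2 ⟨(hKX hy).1, K, fun x hx => (hKX hx).1, hK, hKn, hy, hmax⟩

/-- The number of colours that is lost in `Rooted.extend_of_tail`. -/
def tailBound (ρ τ N : ℕ) : ℕ :=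
  τ * (τ * ((4 * ρ + 3) * τ + N)) + (ρ + 1) * ((4 * ρ + 3) * τ + N)

theorem Rooted.extend_of_tail {G : SimpleGraph V} {φ : ℕ → ℕ} {ρ τ n L N h : ℕ} {o d q : V}
    {F Y Y₀ B : Set V} {e : V → V} {cls : V → ℕ} {x : ℕ → V} (hG : Tame φ ρ τ G) (hρ : 3 ≤ ρ)
    (hR : Rooted G ρ o q n L F Y e cls) (ho : o ∈ F) (hd : d ∈ F) (hq : q ∈ F)
    (hY₀ : Y₀ ⊆ Y) (hcls : ∀ y ∈ Y₀, ∀ y' ∈ Y₀, G.Adj y y' → cls y ≠ cls y')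
    (hx0 : x 0 ∈ lastInClique G cls (lastInClique G cls Y₀)) (hhρ : h ≤ ρ) (hx : IndPath G x h)
    (hxY : ∀ j ≤ h, x j ∈ Y₀) (hxd : ∀ j, 3 ≤ j → j ≤ h → x j ∉ walkBall G 2 (x 0))
    (hxc : ∀ j ≤ h, cls (x 0) ≤ cls (x j))
    (hxe : ∀ j, 1 ≤ j → j ≤ h → ¬ G.Adj (e (x 0)) (x j))
    (hB : HasWalks G ρ Y₀ B (x h) fun c => cls (x 0) ≤ cls c ∧ ¬ G.Adj (e (x 0)) c)
    (hN : ¬ ColorableOn G B (tailBound ρ τ N)) :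
    ∃ m ≤ ρ, ∃ B' ⊆ B, ¬ ColorableOn G B' N ∧ HasLinks G ρ o d q (n + 1) (L + m + 1) B' := by
  classical
  have hB' : ∀ b, ∃ c : ℕ → V, b ∈ B → c 0 = x h ∧ c ρ = b ∧
      (∀ j < ρ, G.Adj (c j) (c (j + 1))) ∧ (∀ j ≤ ρ, c j ∈ Y₀) ∧
      cls (x 0) ≤ cls (c 1) ∧ ¬ G.Adj (e (x 0)) (c 1) := fun b => by
    by_cases hb : b ∈ B
    · obtain ⟨c, hc⟩ := hB b hb
      exact ⟨c, fun _ => hc⟩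
    · exact ⟨fun _ => o, fun h => (hb h).elim⟩
  choose c hc using hB'
  obtain ⟨-, K, hKY, hK, hKn, hwK, hwmax⟩ := hx0
  have hK₀ : ∀ k ∈ K, k ∈ Y₀ := fun k hk => (hKY hk).1
  have hne : ∀ y ∈ Y₀, ∀ y' ∈ Y₀, cls y < cls y' → ¬ G.Adj (e y) y' := fun y hy y' hy' hlt hadj =>
    (hR.le y (hY₀ hy) y' (hY₀ hy') hadj).not_gt hlt
  have hlt : ∀ k ∈ K, k ≠ x 0 → cls k < cls (x 0) := fun k hk hkw =>
    lt_of_le_of_ne (hwmax k hk) (hcls k (hK₀ k hk) _ (hK₀ _ hwK) (hK hk hwK hkw))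
  have hkx : ∀ k ∈ K, ∀ j ≤ h, k ≠ x 0 ∨ 1 ≤ j → ¬ G.Adj (e k) (x j) := by
    intro k hk j hj hor
    by_cases hkw : k = x 0
    · subst hkw
      exact hxe j (hor.resolve_left fun h => h rfl) hj
    · exact hne k (hK₀ k hk) _ (hxY j hj) ((hlt k hk hkw).trans_le (hxc j hj))
  have hkc : ∀ k ∈ K, ∀ b ∈ B, ¬ G.Adj (e k) (c b 1) := by
    intro k hk b hb
    obtain ⟨-, -, -, h4, h5, h6⟩ := hc b hb
    by_cases hkw : k = x 0
    · rwa [hkw]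
    · exact hne k (hK₀ k hk) _ (h4 1 (by omega)) ((hlt k hk hkw).trans_le h5)
  -- replacing the first vertex of a walk
  have hwalk : ∀ w ∈ Y₀, ∀ B' ⊆ B, (∀ b ∈ B', G.Adj w (c b 1)) → ∀ P : V → Prop,
      (∀ b ∈ B', P (c b 1)) → HasWalks G ρ Y B' w P := by
    intro w hw B' hB' hadj P hP b hb
    obtain ⟨-, h2, h3, h4, -⟩ := hc b (hB' hb)
    refine ⟨fun j => if j = 0 then w else c b j, by simp, ?_, ?_, ?_, by simpa using hP b hb⟩
    · simpa [show ρ ≠ 0 by omega] using h2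
    · intro j hj
      by_cases hj0 : j = 0
      · simpa [hj0] using hadj b hb
      · simpa [hj0] using h3 j hj
    · intro j hj
      by_cases hj0 : j = 0
      · simpa [hj0] using hY₀ hw
      · simpa [hj0] using hY₀ (h4 j hj)
  by_cases h1 : ColorableOn G {b ∈ B | ∃ m ∈ K, G.Adj m (c b 1)} (τ * (τ * ((4 * ρ + 3) * τ + N)))
  · have h2 : ¬ ColorableOn G {b ∈ B | ∀ m ∈ K, ¬ G.Adj m (c b 1)}
        ((ρ + 1) * ((4 * ρ + 3) * τ + N)) := by
      refine not_colorableOn_of_cover hN h1 fun b hb => ?_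
      by_cases h : ∃ m ∈ K, G.Adj m (c b 1)
      · exact Or.inl ⟨hb, h⟩
      · exact Or.inr ⟨hb, by simpa using h⟩
    obtain ⟨j, hj, h3⟩ := exists_not_colorableOn (Finset.range (h + 1))
      (fun j => {b | G.Adj (x j) (c b 1) ∧ ∀ i < j, ¬ G.Adj (x i) (c b 1)})
      (by simpa using hhρ) h2 (by
        rintro b ⟨hb, -⟩
        have hex : ∃ j, G.Adj (x j) (c b 1) := ⟨h, by
          obtain ⟨h4, -, h5, -⟩ := hc b hb
          rw [← h4]
          exact h5 0 (by omega)⟩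
        refine ⟨Nat.find hex, ?_, Nat.find_spec hex, fun i hi => Nat.find_min hex hi⟩
        rw [Finset.mem_range]
        refine Nat.lt_succ_of_le (Nat.find_min' hex ?_)
        obtain ⟨h4, -, h5, -⟩ := hc b hb
        rw [← h4]
        exact h5 0 (by omega))
    rw [Finset.mem_range] at hj
    have hsub : {b ∈ B | ∀ m ∈ K, ¬ G.Adj m (c b 1)} ∩
        {b | G.Adj (x j) (c b 1) ∧ ∀ i < j, ¬ G.Adj (x i) (c b 1)} ⊆ B := fun b hb => hb.1.1
    have hj1 : 1 ≤ j := by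
      by_contra h0
      obtain rfl : j = 0 := by omega
      obtain ⟨b, hb⟩ : ({b ∈ B | ∀ m ∈ K, ¬ G.Adj m (c b 1)} ∩
          {b | G.Adj (x 0) (c b 1) ∧ ∀ i < 0, ¬ G.Adj (x i) (c b 1)}).Nonempty := by
        by_contra hemp
        exact h3 (ColorableOn.of_empty (Set.not_nonempty_iff_eq_empty.1 hemp).subset)
      exact hb.1.2 _ hwK hb.2.1
    by_cases hcase : 2 ≤ j ∧ ∃ m ∈ K, G.Adj m (x 2)
    · obtain ⟨hj2, a, haK, ha⟩ := hcase
      obtain ⟨m, rfl⟩ := Nat.exists_eq_add_of_le' hj1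
      obtain ⟨B', hB', h4⟩ := hR.extend_shortcut hG hρ ho hd hq (by omega) (by omega)
        (hx.mono (by omega)) (fun i hi => hY₀ (hxY i (by omega))) (hY₀ (hK₀ a haK)) ha
        (fun i hi1 hi2 hadj => hxd i hi1 (by omega) (by
          by_cases haw : x 0 = a
          · rw [haw]
            exact adj_mem_walkBall hadj (by omega)
          · exact walkBall_adj (adj_mem_walkBall (hK hwK haK haw) le_rfl) hadj))
        (fun i hi1 hi2 => hxe i hi1 (by omega))
        (fun i hi1 hi2 => hkx a haK i (by omega) (Or.inr (by omega)))
        (hwalk _ (hxY _ (by omega)) _ hsub (fun b hb => hb.2.1) _ fun b hb =>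
          ⟨hb.2.2, hb.1.2 a haK, hkc _ hwK b hb.1.1, hkc a haK b hb.1.1⟩) h3
      exact ⟨m, by omega, B', hB'.trans hsub, h4⟩
    · obtain ⟨a, haK, ha⟩ := hKn (x 1)
      have haw : a ≠ x 0 := fun h => ha (h ▸ hx.adj (by omega))
      obtain ⟨B', hB', h4⟩ := hR.extend_pendant hG hρ ho hd hq (m := j) (by omega)
        (hx.mono (by omega)) (fun i hi => hY₀ (hxY i (by omega))) (hY₀ (hK₀ a haK))
        (hK haK hwK haw)
        (fun i hi1 hi2 hadj => by
          by_cases hi : i = 1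
          · exact ha (hi ▸ hadj)
          by_cases hi' : i = 2
          · exact hcase ⟨by omega, a, haK, hi' ▸ hadj⟩
          exact hxd i (by omega) (by omega)
            (walkBall_adj (adj_mem_walkBall (hK hwK haK haw.symm) le_rfl) hadj))
        (fun i hi1 hi2 => hxe i hi1 (by omega))
        (fun i hi => hkx a haK i (by omega) (Or.inl haw))
        (hwalk _ (hxY _ (by omega)) _ hsub (fun b hb => hb.2.1) _ fun b hb =>
          ⟨hb.2.2, hb.1.2 a haK, hkc _ hwK b hb.1.1, hkc a haK b hb.1.1⟩) h3
      exact ⟨j, by omega, B', hB'.trans hsub, h4⟩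
  · obtain ⟨m, hmK, h2⟩ := exists_not_colorableOn K (fun m => {b | G.Adj m (c b 1)})
      (hG.card_le_of_isClique (by omega) hK) h1 (fun b hb => hb.2)
    obtain ⟨-, K', hKY', hK', hKn', hmK', hmmax⟩ := hKY hmK
    obtain ⟨a, haK, h3⟩ := exists_not_colorableOn K' (fun a => {b | ¬ G.Adj a (c b 1)})
      (hG.card_le_of_isClique (by omega) hK') h2 (fun b _ => hKn' (c b 1))
    have hsub : {b ∈ B | ∃ m ∈ K, G.Adj m (c b 1)} ∩ {b | G.Adj m (c b 1)} ∩
        {b | ¬ G.Adj a (c b 1)} ⊆ B := fun b hb => hb.1.1.1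
    have ham : a ≠ m := by
      rintro rfl
      refine h3 (ColorableOn.of_empty fun b hb => hb.2 hb.1.2)
    have ha₀ : a ∈ Y₀ := hKY' haK
    have halt : cls a < cls m := lt_of_le_of_ne (hmmax a haK)
      (hcls a ha₀ m (hK₀ m hmK) (hK' haK hmK' ham))
    obtain ⟨B', hB', h4⟩ := hR.extend_pendant hG hρ ho hd hq (m := 0) (x := fun _ => m) (by omega)
      (fun i j hij hj => by omega) (fun i hi => hY₀ (hK₀ m hmK)) (hY₀ ha₀)
      (hK' haK hmK' ham) (fun i hi1 hi2 => by omega) (fun i hi1 hi2 => by omega)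
      (fun i hi => hne a ha₀ m (hK₀ m hmK) halt)
      (hwalk m (hK₀ m hmK) _ hsub (fun b hb => hb.1.2) _ fun b hb =>
          ⟨fun i hi => by omega, hb.2, hkc m hmK b hb.1.1.1, by
            obtain ⟨-, -, -, h4, h5, h6⟩ := hc b hb.1.1.1
            exact hne a ha₀ _ (h4 1 (by omega)) (halt.trans_le ((hwmax m hmK).trans h5))⟩) h3
    exact ⟨0, by omega, B', hB'.trans hsub, h4⟩

/-- The number of colours that is lost in `HasLinks.extend`. -/
def linkBound (φ : ℕ → ℕ) (ρ τ N : ℕ) : ℕ :=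
  let P := tailBound ρ τ N
  τ * (τ + (τ + φ (τ + (P + (τ + φ (τ + P))))))

theorem Rooted.exists_distinct_cls {G : SimpleGraph V} {φ : ℕ → ℕ} {ρ τ n L N : ℕ} {o q : V}
    {F Y : Set V} {e : V → V} {cls : V → ℕ} (hG : Tame φ ρ τ G) (hρ : 2 ≤ ρ)
    (hR : Rooted G ρ o q n L F Y e cls) (hY : ¬ ColorableOn G Y (τ * N)) :
    ∃ Y₀ ⊆ Y, ¬ ColorableOn G Y₀ N ∧ ∀ y ∈ Y₀, ∀ y' ∈ Y₀, G.Adj y y' → cls y ≠ cls y' := by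
  have h1 : ∀ v, ∃ f : V → ℕ, (∀ u ∈ walkBall G (ρ - 1) v, f u < τ) ∧
      ∀ u ∈ walkBall G (ρ - 1) v, ∀ w ∈ walkBall G (ρ - 1) v, G.Adj u w → f u ≠ f w :=
    fun v => hG.ball v
  choose f hf hfa using h1
  have hmem : ∀ y ∈ Y, y ∈ walkBall G (ρ - 1) (e y) := fun y hy =>
    adj_mem_walkBall (hR.adj y hy) (by omega)
  obtain ⟨k, -, hk⟩ := exists_not_colorableOn (Finset.range τ) (fun k => {y | f (e y) y = k})
    (by simp) hY fun y hy => ⟨_, by simpa using hf _ _ (hmem y hy), rfl⟩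
  refine ⟨_, Set.inter_subset_left, hk, ?_⟩
  rintro y ⟨hy, hyk⟩ y' ⟨hy', hyk'⟩ hadj hcls
  have he := hR.inj y hy y' hy' hcls
  refine hfa (e y) y (hmem y hy) y' (he ▸ hmem y' hy') hadj ?_
  rw [Set.mem_ofPred_eq] at hyk hyk'
  rw [hyk, he, hyk']

theorem HasLinks.extend [Finite V] {G : SimpleGraph V} {φ : ℕ → ℕ} {ρ τ n lam N : ℕ} {o d q : V}
    {B : Set V} (hG : Tame φ ρ τ G) (hρ : 3 ≤ ρ) (h : HasLinks G ρ o d q n lam B)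
    (hB : ¬ ColorableOn G B (linkBound φ ρ τ N)) :
    ∃ m ≤ ρ, ∃ B', ¬ ColorableOn G B' N ∧ HasLinks G ρ o d q (n + 1) (lam + (ρ + m)) B' := by
  classical
  have : Nonempty V := ⟨o⟩
  suffices hs : ∃ m ≤ ρ, ∃ B', ¬ ColorableOn G B' N ∧
      HasLinks G ρ o d q (n + 1) (lam + ρ - 1 + m + 1) B' by
    obtain ⟨m, hm, B', hN, hL⟩ := hs
    refine ⟨m, hm, B', hN, ?_⟩
    rwa [show lam + (ρ + m) = lam + ρ - 1 + m + 1 by omega]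
  obtain ⟨F, e, cls, ho, hd, hq, hR⟩ := h.exists_rooted hρ
  obtain ⟨Y₀, hY₀, hcol, hcls⟩ := hR.exists_distinct_cls hG (by omega) hB
  have hcol₂ := hG.not_colorableOn_lastInClique cls (hG.not_colorableOn_lastInClique cls hcol)
  set Y₂ := lastInClique G cls (lastInClique G cls Y₀) with hY₂
  have hY₂₀ : Y₂ ⊆ Y₀ := fun y hy => hy.1.1
  have hsphere := hG.sphere _ _ hcol₂
  clear_value Y₂
  obtain ⟨z, hz, B₁, hB₁, hcol₁, hg⟩ := hsphere
  have hg' : ∀ b, ∃ g : ℕ → V, b ∈ B₁ → g 0 = z ∧ g ρ = b ∧ (∀ j ≤ ρ, g j ∈ Y₂) ∧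
      ∀ j < ρ, G.Adj (g j) (g (j + 1)) := fun b => by
    by_cases hb : b ∈ B₁
    · obtain ⟨-, t, ht⟩ := hg b hb
      exact ⟨t, fun _ => ht⟩
    · exact ⟨fun _ => z, fun h => (hb h).elim⟩
  choose g hg' using hg'
  have hgfar : ∀ b ∈ B₁, g b ρ ∉ walkBall G (ρ - 1) (g b 0) := fun b hb => by
    rw [(hg' b hb).1, (hg' b hb).2.1]
    exact (hg b hb).1
  have hgind : ∀ b ∈ B₁, IndPath G (g b) ρ := fun b hb =>
    IndPath.of_geodesic (hg' b hb).2.2.2 (hgfar b hb)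
  obtain ⟨b₁, hb₁⟩ : B₁.Nonempty := by
    by_contra hemp
    exact hcol₁ (ColorableOn.of_empty (Set.not_nonempty_iff_eq_empty.1 hemp).subset)
  have hexi : ∃ i, ∃ b ∈ B₁, ∃ j ≤ ρ, cls (g b j) = i := ⟨_, b₁, hb₁, 0, by omega, rfl⟩
  have hexh : ∃ j ≤ ρ, ∃ b ∈ B₁, cls (g b j) = Nat.find hexi := by
    obtain ⟨b, hb, j, hj, h⟩ := Nat.find_spec hexi
    exact ⟨j, hj, b, hb, h⟩
  obtain ⟨k, hk, b₀, hb₀, hw, hmin, hminh⟩ : ∃ k ≤ ρ, ∃ b₀ ∈ B₁,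
      cls (g b₀ k) = Nat.find hexi ∧ (∀ b ∈ B₁, ∀ j ≤ ρ, cls (g b₀ k) ≤ cls (g b j)) ∧
      ∀ b ∈ B₁, ∀ j < k, cls (g b j) ≠ cls (g b₀ k) := by
    obtain ⟨h1, b₀, hb₀, h2⟩ := Nat.find_spec hexh
    refine ⟨Nat.find hexh, h1, b₀, hb₀, h2, fun b hb j hj => ?_, fun b hb j hj h => ?_⟩
    · rw [h2]
      exact Nat.find_min' hexi ⟨b, hb, j, hj, rfl⟩
    · exact Nat.find_min hexh hj ⟨by omega, b, hb, h.trans h2⟩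
  have hgY : ∀ b ∈ B₁, ∀ j ≤ ρ, g b j ∈ B := fun b hb j hj =>
    hY₀ (hY₂₀ ((hg' b hb).2.2.1 j hj))
  by_cases hA : ColorableOn G {b ∈ B₁ | ¬ G.Adj (e (g b₀ k)) (g b 1)} (tailBound ρ τ N)
  · have hcolB : ¬ ColorableOn G {b ∈ B₁ | G.Adj (e (g b₀ k)) (g b 1)}
        (τ + φ (τ + tailBound ρ τ N)) := by
      refine not_colorableOn_of_cover hcol₁ hA fun b hb => ?_
      by_cases h : G.Adj (e (g b₀ k)) (g b 1)
      · exact Or.inr ⟨hb, h⟩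
      · exact Or.inl ⟨hb, h⟩
    have hcol₃ := hG.not_colorableOn_diff (s := 1) (N := φ (τ + tailBound ρ τ N))
      {e (g b₀ k)} (by simp) (by rwa [one_mul])
    simp only [Finset.mem_singleton, forall_eq] at hcol₃
    obtain ⟨z', ⟨⟨hz'B, hz'a⟩, hz'r⟩, B₄, hB₄, hcol₄, hg₄⟩ := hG.sphere _ _ hcol₃
    obtain ⟨hz0, hzρ, hzY, hza⟩ := hg' z' hz'B
    have hcz : cls (g z' 1) = cls (g b₀ k) :=
      le_antisymm (hR.le _ (hgY b₀ hb₀ k hk) _ (hgY z' hz'B 1 (by omega)) hz'a)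
        (hmin z' hz'B 1 (by omega))
    have hez : e (g z' 1) = e (g b₀ k) :=
      hR.inj _ (hgY z' hz'B 1 (by omega)) _ (hgY b₀ hb₀ k hk) hcz
    have hres := hR.extend_of_tail (x := fun j => g z' (1 + j)) (h := ρ - 1) (B := B₄) (N := N)
      hG hρ ho hd hq hY₀ hcls (hY₂ ▸ hzY 1 (by omega)) (by omega)
      ((hgind z' hz'B).shift (by omega)) (fun j hj => hY₂₀ (hzY _ (by omega)))
      (fun j hj1 hj2 => geodesic_notMem hza (hgfar z' hz'B) (by omega) (by omega))
      (fun j hj => hcz.trans_le (hmin z' hz'B _ (by omega)))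
      (fun j hj1 hj2 hadj => hz'r (by
        have h2 := chain_mem_walkBall' hza (i := 1 + j) (j := ρ) (d := ρ - 1 - j) (by omega)
          le_rfl (by omega)
        rw [hzρ] at h2
        refine walkBall_mono (walkBall_trans (adj_mem_walkBall ?_ le_rfl) h2) (by omega)
        simpa [hez] using hadj))
      (fun b hb => by
        obtain ⟨-, c, hc0, hcρ, hcY, hca⟩ := hg₄ b hb
        refine ⟨c, ?_, hcρ, hca, fun j hj => hY₂₀ (hB₁ (hcY j hj).1.1), ?_, ?_⟩
        · rw [show 1 + (ρ - 1) = ρ by omega, hzρ, hc0]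
        · have h1 : c 1 ∈ B₁ := (hcY 1 (by omega)).1.1
          have h2 := hmin _ h1 ρ le_rfl
          rw [(hg' _ h1).2.1] at h2
          exact hcz.trans_le h2
        · intro hadj
          refine (hcY 1 (by omega)).2 (adj_mem_walkBall ?_ (by omega))
          simpa [hez] using hadj) hcol₄
    obtain ⟨m, hm, B', -, h⟩ := hres
    exact ⟨m, hm, B', h⟩
  · obtain ⟨hz0, -, hwY, hwa⟩ := hg' b₀ hb₀
    have hres := hR.extend_of_tail (x := fun j => g b₀ (k - j)) (h := k) (N := N)
      hG hρ ho hd hq hY₀ hcls (hY₂ ▸ hwY k hk) hk ((hgind b₀ hb₀).mono hk).reverse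
      (fun j hj => hY₂₀ (hwY _ (by omega)))
      (fun j hj1 hj2 hmem => geodesic_notMem hwa (hgfar b₀ hb₀) (i := k - j) (j := k) (d := 2)
        (by omega) hk (walkBall_symm hmem))
      (fun j hj => hmin b₀ hb₀ _ (by omega))
      (fun j hj1 hj2 hadj => hminh b₀ hb₀ (k - j) (by omega) (le_antisymm
        (hR.le _ (hgY b₀ hb₀ k hk) _ (hgY b₀ hb₀ _ (by omega)) hadj)
        (hmin b₀ hb₀ _ (by omega))))
      (fun b hb => by
        obtain ⟨h1, h2, h3, h4⟩ := hg' b hb.1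
        refine ⟨g b, ?_, h2, h4, fun j hj => hY₂₀ (h3 j hj), hmin b hb.1 1 (by omega), hb.2⟩
        rw [h1, Nat.sub_self, hz0]) hA
    obtain ⟨m, hm, B', -, h⟩ := hres
    exact ⟨m, hm, B', h⟩

/-- The number of colours that is lost in `Tame.exists_hasLinks`. -/
def initBound (φ : ℕ → ℕ) (ρ τ N : ℕ) : ℕ :=
  φ (τ + φ (τ + ((ρ + 1) * τ + (N + N))))

theorem Tame.exists_hasLinks {G : SimpleGraph V} {φ : ℕ → ℕ} {ρ τ N : ℕ}
    (hG : Tame φ ρ τ G) (hρ : 3 ≤ ρ) (hV : ¬ ColorableOn G Set.univ (initBound φ ρ τ N)) :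
    ∃ o d q, G.Adj o d ∧ G.Adj d q ∧ ¬ G.Adj o q ∧ o ≠ q ∧
      ∃ lam, (lam = ρ - 3 ∨ lam = ρ - 2) ∧ ∃ B, ¬ ColorableOn G B N ∧
        HasLinks G ρ o d q 0 lam B := by
  classical
  obtain ⟨o, -, B₀, -, hcol₀, hB₀⟩ := hG.sphere _ _ hV
  obtain ⟨p, hp, B₁, hB₁, hcol₁, hc⟩ := hG.sphere _ _ hcol₀
  have hlayer : ∀ b ∈ B₀, b ∈ layer G ρ o := fun b hb => by
    obtain ⟨h, t, ht0, htρ, -, hta⟩ := hB₀ b hb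
    refine ⟨?_, h⟩
    have := chain_mem_walkBall' (d := ρ) hta (Nat.zero_le ρ) le_rfl (by omega)
    rwa [ht0, htρ] at this
  obtain ⟨hpo, e, he0, heρ, -, hea⟩ := hB₀ p hp
  have hpe : e ρ ∉ walkBall G (ρ - 1) (e 0) := by rwa [he0, heρ]
  have hei : IndPath G e ρ := IndPath.of_geodesic hea hpe
  have hc' : ∀ b, ∃ c : ℕ → V, b ∈ B₁ → c 0 = p ∧ c ρ = b ∧ (∀ j ≤ ρ, c j ∈ B₀) ∧
      ∀ j < ρ, G.Adj (c j) (c (j + 1)) := fun b => by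
    by_cases hb : b ∈ B₁
    · obtain ⟨-, t, ht⟩ := hc b hb
      exact ⟨t, fun _ => ht⟩
    · exact ⟨fun _ => o, fun h => (hb h).elim⟩
  choose c hc' using hc'
  let F : Finset V := (Finset.range (ρ + 1)).image e
  have hF : ∀ j ≤ ρ, e j ∈ (F : Set V) := fun j hj =>
    Finset.mem_image_of_mem e (by simpa using by omega)
  have hcol₂ := hG.not_colorableOn_diff F (Finset.card_image_le.trans (by simp)) hcol₁
  have key : ∀ k, (k = ρ - 1 ∨ k = ρ) → ∀ B' ⊆ {b ∈ B₁ | ∀ x ∈ F, b ∉ walkBall G (ρ - 1) x},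
      (∀ b ∈ B', ∀ j, ρ - 1 ≤ j → j ≤ k → (G.Adj (e j) (c b 1) ↔ j = k)) →
      HasLinks G ρ o (e 1) (e 2) 0 (k - 2) B' := by
    intro k hk B' hB' hadj
    refine ⟨F, e ρ, hF ρ le_rfl, he0 ▸ hF 0 (by omega), hF 1 (by omega), hF 2 (by omega),
      fun b hb => ?_⟩
    obtain ⟨hb₁, hbF⟩ := hB' hb
    obtain ⟨hc0, hcρ, hcB, hca⟩ := hc' b hb₁
    refine ⟨hlayer b (hB₁ hb₁), hbF, c b, hc0.trans heρ.symm, hcρ, hca,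
      fun j _ hj => hlayer _ (hcB j hj), fun i hi => ?_⟩
    obtain rfl : i = 0 := by omega
    refine ⟨{x | ∃ j, 2 ≤ j ∧ j ≤ k ∧ x = e j}, ?_, e k, ⟨k, by omega, le_rfl, rfl⟩,
      ⟨fun j => e (2 + j), rfl, ?_, fun j hj => ⟨2 + j, by omega, by omega, rfl⟩,
        hei.shift (by omega)⟩, ?_, ?_⟩
    · rintro x ⟨j, -, hj, rfl⟩
      exact hF j (by omega)
    · show e (2 + (k - 2 + 0)) = e k
      congr 1
      omega
    · rintro x ⟨j, hj2, hj, rfl⟩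
      by_cases hjρ : ρ - 1 ≤ j
      · rw [hadj b hb j hjρ hj]
        refine ⟨fun h => by rw [h], fun h => ?_⟩
        by_contra hne
        exact (hei j k (by omega) (by omega)).1 h
      · refine iff_of_false (fun h => ?_) (hei j k (by omega) (by omega)).1
        have h1 := chain_mem_walkBall' (d := j) hea (Nat.zero_le j) (by omega) (by omega)
        rw [he0] at h1
        exact (hlayer _ (hcB 1 (by omega))).2 (walkBall_mono (walkBall_adj h1 h) (by omega))
    · rintro x ⟨j, hj2, hj, rfl⟩
      by_cases h : j = 2
      · exact Or.inl (by rw [h])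
      · exact Or.inr (he0 ▸ geodesic_notMem hea hpe (by omega) (by omega))
  have hodq : G.Adj o (e 1) ∧ G.Adj (e 1) (e 2) ∧ ¬ G.Adj o (e 2) ∧ o ≠ e 2 :=
    ⟨he0 ▸ hea 0 (by omega), hea 1 (by omega), he0 ▸ hei.not_adj (by omega) (by omega),
      he0 ▸ (hei 0 2 (by omega) (by omega)).1⟩
  refine ⟨o, e 1, e 2, hodq.1, hodq.2.1, hodq.2.2.1, hodq.2.2.2, ?_⟩
  by_cases hA : ColorableOn G ({b ∈ B₁ | ∀ x ∈ F, b ∉ walkBall G (ρ - 1) x} ∩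
      {b | G.Adj (e (ρ - 1)) (c b 1)}) N
  · refine ⟨ρ - 2, Or.inr rfl, {b ∈ B₁ | ∀ x ∈ F, b ∉ walkBall G (ρ - 1) x} ∩
      {b | ¬ G.Adj (e (ρ - 1)) (c b 1)}, ?_, key ρ (Or.inr rfl) _ Set.inter_subset_left ?_⟩
    · refine not_colorableOn_of_cover hcol₂ hA fun b hb => ?_
      by_cases h : G.Adj (e (ρ - 1)) (c b 1)
      · exact Or.inl ⟨hb, h⟩
      · exact Or.inr ⟨hb, h⟩
    · intro b hb j hj1 hj2
      by_cases hj : j = ρ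
      · refine iff_of_true ?_ hj
        obtain ⟨hc0, -, -, hca⟩ := hc' b hb.1.1
        rw [hj, heρ, ← hc0]
        exact hca 0 (by omega)
      · obtain rfl : j = ρ - 1 := by omega
        exact iff_of_false hb.2 hj
  · refine ⟨ρ - 3, Or.inl rfl, _, hA, key (ρ - 1) (Or.inl rfl) _ Set.inter_subset_left ?_⟩
    intro b hb j hj1 hj2
    obtain rfl : j = ρ - 1 := by omega
    exact iff_of_true hb.2 rfl

theorem exists_cycle_of_hasLinks (φ : ℕ → ℕ) {ρ ℓ : ℕ} (τ : ℕ) (hρ : 3 ≤ ρ)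
    (hℓ : 8 * ρ ^ 2 + 6 * ρ ≤ ℓ) (k lam n : ℕ) (hk : ℓ - lam ≤ k)
    (hlam : lam ≤ ρ + 2 * ρ * n) (hlamℓ : lam + 2 * ρ + 2 ≤ ℓ) :
    ∃ M : ℕ, ∀ (V : Type) [Finite V] (G : SimpleGraph V), Tame φ ρ τ G → ∀ o d q : V,
      G.Adj o d → G.Adj d q → ¬ G.Adj o q → o ≠ q → ∀ B : Set V, HasLinks G ρ o d q n lam B →
      ¬ ColorableOn G B M → Nonempty (cycleGraph ℓ ↪g G) := by
  induction k generalizing lam n with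
  | zero => omega
  | succ k ih =>
    by_cases hclose : ℓ ≤ lam + n + ρ + 1
    · refine ⟨0, fun V _ G hG o d q hod hdq hoq hne B hB hcol => ?_⟩
      obtain ⟨b, hb⟩ : B.Nonempty := by
        by_contra hemp
        exact hcol (ColorableOn.of_empty (Set.not_nonempty_iff_eq_empty.1 hemp).subset)
      obtain ⟨s, hs, j, hj1, hjρ, h⟩ := hB.exists_cycles hρ hod hdq hoq hne hb
      have := h (ℓ - (lam + j + ρ + s)) (by omega)
      rwa [show lam + (ℓ - (lam + j + ρ + s)) + j + ρ + s = ℓ by omega] at this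
    · have hlam' : lam + 4 * ρ + 2 ≤ ℓ := by
        rcases le_or_gt (3 * ρ) n with hn | hn
        · omega
        · obtain ⟨r, hr⟩ := Nat.exists_eq_add_of_lt hn
          nlinarith
      have hM : ∀ m, ∃ M : ℕ, m ≤ ρ → ∀ (V : Type) [Finite V] (G : SimpleGraph V),
          Tame φ ρ τ G → ∀ o d q : V, G.Adj o d → G.Adj d q → ¬ G.Adj o q → o ≠ q →
          ∀ B : Set V, HasLinks G ρ o d q (n + 1) (lam + (ρ + m)) B →
          ¬ ColorableOn G B M → Nonempty (cycleGraph ℓ ↪g G) := fun m => by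
        by_cases hm : m ≤ ρ
        · obtain ⟨M, hM⟩ := ih (lam + (ρ + m)) (n + 1) (by omega) (by nlinarith) (by omega)
          exact ⟨M, fun _ => hM⟩
        · exact ⟨0, fun h => (hm h).elim⟩
      choose M hM using hM
      refine ⟨linkBound φ ρ τ (∑ m ∈ Finset.range (ρ + 1), M m),
        fun V _ G hG o d q hod hdq hoq hne B hB hcol => ?_⟩
      obtain ⟨m, hm, B', hcol', hB'⟩ := hB.extend hG hρ hcol
      refine hM m hm V G hG o d q hod hdq hoq hne B' hB' fun h => hcol' (h.mono subset_rfl ?_)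
      exact Finset.single_le_sum (f := M) (fun _ _ => Nat.zero_le _) (by simpa using by omega)

theorem exists_cycle_of_tame (φ : ℕ → ℕ) {ρ ℓ : ℕ} (τ : ℕ) (hρ : 3 ≤ ρ)
    (hℓ : 8 * ρ ^ 2 + 6 * ρ ≤ ℓ) :
    ∃ M : ℕ, ∀ (V : Type) [Finite V] (G : SimpleGraph V), Tame φ ρ τ G →
      ¬ ColorableOn G Set.univ M → Nonempty (cycleGraph ℓ ↪g G) := by
  obtain ⟨M₁, hM₁⟩ := exists_cycle_of_hasLinks φ τ hρ hℓ _ (ρ - 3) 0 le_rfl (by omega)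
    (by nlinarith [Nat.sub_le ρ 3])
  obtain ⟨M₂, hM₂⟩ := exists_cycle_of_hasLinks φ τ hρ hℓ _ (ρ - 2) 0 le_rfl (by omega)
    (by nlinarith [Nat.sub_le ρ 2])
  refine ⟨initBound φ ρ τ (M₁ + M₂), fun V _ G hG hcol => ?_⟩
  obtain ⟨o, d, q, hod, hdq, hoq, hne, lam, rfl | rfl, B, hB, hL⟩ := hG.exists_hasLinks hρ hcol
  · exact hM₁ V G hG o d q hod hdq hoq hne B hL fun h => hB (h.mono subset_rfl (by omega))
  · exact hM₂ V G hG o d q hod hdq hoq hne B hL fun h => hB (h.mono subset_rfl (by omega))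

/-- If `χ(G)` is large, every hole of `G` is peripheral. -/
theorem Tame.lt_chromaticNumber_periphSet {G : SimpleGraph V} {φ : ℕ → ℕ} {ρ τ n d : ℕ}
    (hG : Tame φ ρ τ G) (hρ : 2 ≤ ρ) (hV : ¬ ColorableOn G Set.univ (n * τ + d))
    (f : cycleGraph n ↪g G) : (d : ℕ∞) < (G.induce (periphSet G f)).chromaticNumber := by
  classical
  rw [← not_le, ← colorableOn_iff]
  intro h
  refine hG.not_colorableOn_diff (s := n) (Finset.univ.image f)
    (Finset.card_image_le.trans (by simp)) hV (h.mono ?_ le_rfl)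
  rintro v ⟨-, hv⟩
  refine ⟨?_, ?_⟩
  · rintro ⟨i, rfl⟩
    exact hv _ (Finset.mem_image_of_mem f (Finset.mem_univ i)) self_mem_walkBall
  · rintro _ ⟨i, rfl⟩ hadj
    exact hv _ (Finset.mem_image_of_mem f (Finset.mem_univ i))
      (adj_mem_walkBall hadj.symm (by omega))

theorem stmt16 (φ : ℕ → ℕ) (hφ : Monotone φ) (ρ ℓ d τ : ℕ) (hρ : 3 ≤ ρ)
    (hℓ : 8 * ρ ^ 2 + 6 * ρ ≤ ℓ) :
    ∃ c : ℕ, ∀ (V : Type) [Fintype V] (G : SimpleGraph V),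
      Controlled ρ φ G →
      (c : ℕ∞) < G.chromaticNumber →
      chiRho G (ρ - 1) ≤ (τ : ℕ∞) →
      (∀ Y : Set V, (G.induce Y).cliqueNum < G.cliqueNum →
        (G.induce Y).chromaticNumber ≤ (τ : ℕ∞)) →
      HasPeriphHole G d ℓ := by
  obtain ⟨M, hM⟩ := exists_cycle_of_tame φ τ hρ hℓ
  refine ⟨ℓ * τ + d + M, fun V _ G hG hχ hτ hω => ?_⟩
  have hT := Tame.of_controlled hφ (by omega) hG hτ hω
  have hV : ¬ ColorableOn G Set.univ (ℓ * τ + d + M) := by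
    rintro ⟨f, hf, hfa⟩
    refine hχ.not_ge (chromaticNumber_le_iff_colorable.2 ⟨Coloring.mk
      (fun v => (⟨f v, hf v trivial⟩ : Fin _)) fun {u v} huv h => ?_⟩)
    exact hfa u trivial v trivial huv (congrArg Fin.val h)
  obtain ⟨f⟩ := hM V G hT fun h => hV (h.mono subset_rfl (by omega))
  exact ⟨by nlinarith, f, hT.lt_chromaticNumber_periphSet (by omega)
    (fun h => hV (h.mono subset_rfl (by omega))) f⟩
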